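/- arXiv:1904.09642 — 4 statements merged into one kernel-verified Lean document; each statement's English description precedes it below -/
import Mathlib

section
/- In the hyperquotient setup with the cA form and Rules I and II, either $\gcd(e,r)=\gcd(d,r)$ and $a$, $b$, $c$ are each coprime to $r$, or $\gcd(e,r)=\gcd(c,r)$ and $a$, $b$, $d$ are each coprime to $r$ (the second alternative corresponding to interchanging the coordinates $z$ and $t$). -/
open scoped BigOperators

namespace GapPaper

/-- Least non-negative residue of `n` modulo `r` (for `r > 0`). -/
def res (r n : ℤ) : ℤ := n % r

/-- The lattice `N = ℤ⁴ + ℤ·(1/r)(a,b,c,d)` inside `ℚ⁴`. -/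
def latN (r a b c d : ℤ) : Set (Fin 4 → ℚ) :=
  {v | ∃ (j : ℤ) (m : Fin 4 → ℤ), ∀ i,
    v i = ((j * ![a, b, c, d] i : ℤ) : ℚ) / (r : ℚ) + (m i : ℚ)}

/-- The positive orthant `σ`. -/
def orth : Set (Fin 4 → ℚ) := {v | ∀ i, 0 ≤ v i}

/-- The weight `w(v) = v₁ + v₂ + v₃ + v₄`. -/
def w (v : Fin 4 → ℚ) : ℚ := ∑ i, v i

/-- `v(f)`: the infimum over the monomials `m ∈ S` of their `v`-weights. -/
noncomputable def vf (S : Set (Fin 4 → ℕ)) (v : Fin 4 → ℚ) : ℝ :=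
  sInf {x : ℝ | ∃ m ∈ S, x = ∑ i : Fin 4, (m i : ℝ) * ((v i : ℚ) : ℝ)}

/-- `v` is primitive in the lattice `N`. -/
def IsPrim (r a b c d : ℤ) (v : Fin 4 → ℚ) : Prop :=
  ¬ ∃ (n : ℤ) (u : Fin 4 → ℚ), 2 ≤ n ∧ u ∈ latN r a b c d ∧ v = fun i => (n : ℚ) * u i

/-- The excluded set `{0, e₁, e₂, e₃, e₄}`. -/
def corners : Set (Fin 4 → ℚ) :=
  {v | v = 0 ∨ ∃ i₀ : Fin 4, v = fun i => if i = i₀ then 1 else 0}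

/-- Every monomial of `S` has weight `e` for the `μ_r`-action with weights
`(a, b, c, d)`. -/
def WeightCond (r a b c d e : ℤ) (S : Set (Fin 4 → ℕ)) : Prop :=
  ∀ m ∈ S, Int.ModEq r ((m 0 : ℤ) * a + (m 1 : ℤ) * b + (m 2 : ℤ) * c + (m 3 : ℤ) * d) e

/-- Rule I: `B` is a set with at most one element, whose element `β` (if any) is
primitive and satisfies `1 - δ < w(β) - β(f) < 1`, and every lattice vector in the
orthant other than `β`, `0`, `e₁`, ..., `e₄` satisfies `w(v) - v(f) > 1`. -/
def RuleI (r a b c d : ℤ) (δ : ℝ) (S : Set (Fin 4 → ℕ)) (B : Set (Fin 4 → ℚ)) : Prop :=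
  B.Subsingleton ∧ B ⊆ latN r a b c d ∩ orth ∧
    (∀ β ∈ B, IsPrim r a b c d β ∧
      1 - δ < ((w β : ℚ) : ℝ) - vf S β ∧ ((w β : ℚ) : ℝ) - vf S β < 1) ∧
    ∀ v ∈ latN r a b c d ∩ orth, v ∉ B → v ∉ corners → 1 < ((w v : ℚ) : ℝ) - vf S v

/-- Rule II. -/
def RuleII (r a b c d e : ℤ) : Prop :=
  (Int.gcd a r ∣ Int.gcd e r) ∧ (Int.gcd b r ∣ Int.gcd e r) ∧
  (Int.gcd c r ∣ Int.gcd e r) ∧ (Int.gcd d r ∣ Int.gcd e r) ∧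
  Int.gcd a (Int.gcd b r) = 1 ∧ Int.gcd a (Int.gcd c r) = 1 ∧
  Int.gcd a (Int.gcd d r) = 1 ∧ Int.gcd b (Int.gcd c r) = 1 ∧
  Int.gcd b (Int.gcd d r) = 1 ∧ Int.gcd c (Int.gcd d r) = 1 ∧
  Int.ModEq r (a + b + c + d - e) 1

/-- The vector `α_k = (1/r)(res(ak), res(bk), res(ck), res(dk))`. -/
def alphaK (r a b c d k : ℤ) : Fin 4 → ℚ :=
  fun i => ((res r (![a, b, c, d] i * k) : ℤ) : ℚ) / (r : ℚ)

/-- The unit cube `[0,1]⁴` minus its 16 vertices. -/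
def cube : Set (Fin 4 → ℚ) :=
  {v | (∀ i, 0 ≤ v i ∧ v i ≤ 1) ∧ ¬ ∀ i, v i = 0 ∨ v i = 1}

/-- The cA form: `f = xy + g(z,t)` with `g ∈ 𝔪²`. -/
def FormCA (S : Set (Fin 4 → ℕ)) : Prop :=
  ![1, 1, 0, 0] ∈ S ∧
    ∀ m ∈ S, m ≠ ![1, 1, 0, 0] → m 0 = 0 ∧ m 1 = 0 ∧ 2 ≤ m 2 + m 3

/-- The square form: `f = x² + (terms of order ≥ 2)`. -/
def FormSq (S : Set (Fin 4 → ℕ)) : Prop :=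
  ![2, 0, 0, 0] ∈ S ∧ ∀ m ∈ S, 2 ≤ m 0 + m 1 + m 2 + m 3

/-- The odd form: `f = x² + y² + g(z,t)` with `g ∈ 𝔪³`. -/
def FormOdd (S : Set (Fin 4 → ℕ)) : Prop :=
  ![2, 0, 0, 0] ∈ S ∧ ![0, 2, 0, 0] ∈ S ∧
    ∀ m ∈ S, m ≠ ![2, 0, 0, 0] → m ≠ ![0, 2, 0, 0] →
      m 0 = 0 ∧ m 1 = 0 ∧ 3 ≤ m 2 + m 3

/-- The cD–E form: `f = x² + g(y,z,t)` with `g ∈ 𝔪³`. -/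
def FormCDE (S : Set (Fin 4 → ℕ)) : Prop :=
  ![2, 0, 0, 0] ∈ S ∧ ∀ m ∈ S, m ≠ ![2, 0, 0, 0] → m 0 = 0 ∧ 3 ≤ m 1 + m 2 + m 3

def vj (g a b c d j : ℤ) : Fin 4 → ℚ :=
  fun i => (((j * ![a, b, c, d] i) % g : ℤ) : ℚ) / (g : ℚ)

theorem key (r g h : ℤ) (δ : ℝ) (a b c d e : ℤ) (S : Set (Fin 4 → ℕ))
    (B : Set (Fin 4 → ℚ)) (hg : 0 < g) (hh : 0 < h) (hrg : r = g * h)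
    (hδ1 : δ ≤ 1 / 13)
    (hwt : WeightCond r a b c d e S) (hge : g ∣ e)
    (hI : RuleI r a b c d δ S B) (hform : FormCA S) (j : ℤ)
    (hja : ¬ g ∣ j * a) (hjb : ¬ g ∣ j * b) (hjc : ¬ g ∣ j * c) (hjd : ¬ g ∣ j * d) :
    g < (j * c) % g + (j * d) % g ∨
      (vj g a b c d j ∈ B ∧ 12 * g < 13 * ((j * c) % g + (j * d) % g)) := by
  obtain ⟨hxy, hS⟩ := hform
  obtain ⟨-, -, hB, hN⟩ := hI
  have hgR : (0 : ℝ) < g := by exact_mod_cast hg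
  have hgQ : (0 : ℚ) < g := by exact_mod_cast hg
  have hhQ : (0 : ℚ) < h := by exact_mod_cast hh
  have pos : ∀ x : ℤ, ¬ g ∣ x → 0 < x % g := fun x hx =>
    lt_of_le_of_ne (Int.emod_nonneg _ hg.ne') (fun h => hx (Int.dvd_of_emod_eq_zero h.symm))
  have hA := pos _ hja
  have hBb := pos _ hjb
  have hC := pos _ hjc
  have hD := pos _ hjd
  have lA := Int.emod_lt_of_pos (j * a) hg
  have lB := Int.emod_lt_of_pos (j * b) hg
  have lC := Int.emod_lt_of_pos (j * c) hg
  have lD := Int.emod_lt_of_pos (j * d) hg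
  -- divisibility
  have hdvd : ∀ m ∈ S, g ∣ (m 0 : ℤ) * ((j * a) % g) + (m 1 : ℤ) * ((j * b) % g)
      + (m 2 : ℤ) * ((j * c) % g) + (m 3 : ℤ) * ((j * d) % g) := by
    intro m hm
    have h1 := (hwt m hm).dvd
    have h2 : g ∣ e - ((m 0 : ℤ) * a + (m 1 : ℤ) * b + (m 2 : ℤ) * c + (m 3 : ℤ) * d) :=
      dvd_trans ⟨h, hrg⟩ h1
    have h3 : g ∣ (m 0 : ℤ) * a + (m 1 : ℤ) * b + (m 2 : ℤ) * c + (m 3 : ℤ) * d :=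
      (dvd_sub_right hge).1 h2
    obtain ⟨k, hk⟩ := h3
    have ea := Int.emod_add_mul_ediv (j * a) g
    have eb := Int.emod_add_mul_ediv (j * b) g
    have ec := Int.emod_add_mul_ediv (j * c) g
    have ed := Int.emod_add_mul_ediv (j * d) g
    refine ⟨j * k - (m 0 * (j * a / g) + m 1 * (j * b / g) + m 2 * (j * c / g)
      + m 3 * (j * d / g)), ?_⟩
    linear_combination (m 0 : ℤ) * ea + (m 1 : ℤ) * eb + (m 2 : ℤ) * ec + (m 3 : ℤ) * ed + j * hk
  have hxys : (j * a) % g + (j * b) % g = g := by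
    have h0 := hdvd _ hxy
    simp at h0
    obtain ⟨k, hk⟩ := h0
    have h1 : 0 < k := by
      by_contra hk0
      nlinarith
    have h2 : k < 2 := by
      by_contra hk0
      nlinarith
    have : k = 1 := by omega
    rw [hk, this, mul_one]
  have hge : ∀ m ∈ S, g ≤ (m 0 : ℤ) * ((j * a) % g) + (m 1 : ℤ) * ((j * b) % g)
      + (m 2 : ℤ) * ((j * c) % g) + (m 3 : ℤ) * ((j * d) % g) := by
    intro m hm
    apply Int.le_of_dvd _ (hdvd m hm)
    by_cases hmx : m = ![1, 1, 0, 0]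
    · subst hmx
      simp
      omega
    · obtain ⟨h0, h1, h2⟩ := hS m hm hmx
      rw [h0, h1]
      have : (2 : ℤ) ≤ m 2 + m 3 := by exact_mod_cast h2
      have p2 : (0 : ℤ) ≤ m 2 := by positivity
      have p3 : (0 : ℤ) ≤ m 3 := by positivity
      push_cast
      nlinarith [mul_nonneg p2 (show (0:ℤ) ≤ (j * c) % g - 1 by omega),
        mul_nonneg p3 (show (0:ℤ) ≤ (j * d) % g - 1 by omega)]
  have hvf : 1 ≤ vf S (vj g a b c d j) := by
    unfold vf
    refine le_csInf (Set.nonempty_of_mem (show _ ∈ _ from ⟨_, hxy, rfl⟩)) ?_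
    rintro x ⟨m, hm, rfl⟩
    have h1 : (g : ℝ) ≤ (m 0 : ℝ) * ((j * a % g : ℤ) : ℝ) + (m 1 : ℝ) * ((j * b % g : ℤ) : ℝ)
      + (m 2 : ℝ) * ((j * c % g : ℤ) : ℝ) + (m 3 : ℝ) * ((j * d % g : ℤ) : ℝ) := by
      exact_mod_cast hge m hm
    have h2 : ∑ i : Fin 4, (m i : ℝ) * ((vj g a b c d j i : ℚ) : ℝ) =
        ((m 0 : ℝ) * ((j * a % g : ℤ) : ℝ) + (m 1 : ℝ) * ((j * b % g : ℤ) : ℝ)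
      + (m 2 : ℝ) * ((j * c % g : ℤ) : ℝ) + (m 3 : ℝ) * ((j * d % g : ℤ) : ℝ)) / g := by
      simp only [Fin.sum_univ_four, vj, Rat.cast_div, Rat.cast_intCast]
      simp
      ring
    rw [h2, le_div_iff₀ hgR]
    linarith
  have hw : ((w (vj g a b c d j) : ℚ) : ℝ) =
      1 + (((j * c) % g + (j * d) % g : ℤ) : ℝ) / g := by
    have h1 : w (vj g a b c d j) = (((j * a) % g + (j * b) % g : ℤ) : ℚ) / g
        + (((j * c) % g + (j * d) % g : ℤ) : ℚ) / g := by
      simp only [w, Fin.sum_univ_four, vj]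
      simp
      ring
    rw [h1, hxys, div_self hgQ.ne']
    push_cast
    rfl
  by_cases hmem : vj g a b c d j ∈ B
  · right
    refine ⟨hmem, ?_⟩
    have h1 := (hB _ hmem).2.1
    rw [hw] at h1
    have h2 : (12 : ℝ) / 13 < (((j * c) % g + (j * d) % g : ℤ) : ℝ) / g := by linarith
    rw [lt_div_iff₀ hgR] at h2
    have h3 : (12 : ℝ) * g < 13 * (((j * c) % g + (j * d) % g : ℤ) : ℝ) := by linarith
    exact_mod_cast h3
  · left
    have h1 := hN (vj g a b c d j) ⟨?_, ?_⟩ hmem ?_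
    · rw [hw] at h1
      have h2 : (1 : ℝ) < (((j * c) % g + (j * d) % g : ℤ) : ℝ) / g := by linarith
      rw [lt_div_iff₀ hgR, one_mul] at h2
      exact_mod_cast h2
    · refine ⟨j * h, fun i => - (j * ![a, b, c, d] i / g), fun i => ?_⟩
      have e1 : (((j * ![a, b, c, d] i) % g : ℤ) : ℚ)
          = j * (![a, b, c, d] i : ℤ) - g * ((j * ![a, b, c, d] i / g : ℤ) : ℚ) := by
        have := Int.emod_add_mul_ediv (j * ![a, b, c, d] i) g
        have h' : (j * ![a, b, c, d] i) % g
          = j * ![a, b, c, d] i - g * (j * ![a, b, c, d] i / g) := by linarith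
        rw [h']
        push_cast
        rfl
      simp only [vj]
      rw [e1, hrg]
      generalize ![a, b, c, d] i = x
      push_cast
      field_simp
      ring
    · intro i
      simp only [vj]
      exact div_nonneg (by exact_mod_cast Int.emod_nonneg _ hg.ne') hgQ.le
    · have q0 : 0 < vj g a b c d j 0 := by
        simp only [vj]
        apply div_pos _ hgQ
        exact_mod_cast hA
      have q1 : vj g a b c d j 0 < 1 := by
        simp only [vj]
        rw [div_lt_one hgQ]
        exact_mod_cast lA
      rintro (hz | ⟨i0, hz⟩)
      · rw [hz] at q0
        simp at q0
      · rw [hz] at q0 q1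
        by_cases hi : (0 : Fin 4) = i0
        · simp [hi] at q1
        · simp [hi] at q0

theorem core (g c d : ℤ) (E : ℤ → Prop) (hcd : g ∣ c + d - 1)
    (hE : ∀ j j', 1 ≤ j → j < g → 1 ≤ j' → j' < g → E j → E j' → j = j')
    (hkey : ∀ j, 1 ≤ j → j < g → ¬ g ∣ j * c → ¬ g ∣ j * d →
      g < (j * c) % g + (j * d) % g ∨ (E j ∧ 12 * g < 13 * ((j * c) % g + (j * d) % g)))
    (hg : 0 < g) : g ∣ c ∨ g ∣ d := by
  have alt : ∀ j, 1 ≤ j → j < g → g ∣ j * c ∨ g ∣ j * d ∨ (E j ∧ 12 * g < 13 * j) ∨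
      (E (g - j) ∧ 12 * g < 13 * (g - j)) := by
    intro j h1 h2
    by_cases hc : g ∣ j * c
    · exact Or.inl hc
    by_cases hd : g ∣ j * d
    · exact Or.inr (Or.inl hd)
    right; right
    have hC : 0 ≤ (j * c) % g := Int.emod_nonneg _ hg.ne'
    have hD : 0 ≤ (j * d) % g := Int.emod_nonneg _ hg.ne'
    have hC0 : (j * c) % g ≠ 0 := fun h => hc (Int.dvd_of_emod_eq_zero h)
    have hD0 : (j * d) % g ≠ 0 := fun h => hd (Int.dvd_of_emod_eq_zero h)
    have lC := Int.emod_lt_of_pos (j * c) hg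
    have lD := Int.emod_lt_of_pos (j * d) hg
    have neg : ∀ x : ℤ, ¬ g ∣ j * x → ((g - j) * x) % g = g - (j * x) % g := by
      intro x hx
      have p0 : 0 ≤ (j * x) % g := Int.emod_nonneg _ hg.ne'
      have p1 : (j * x) % g ≠ 0 := fun h => hx (Int.dvd_of_emod_eq_zero h)
      have p2 := Int.emod_lt_of_pos (j * x) hg
      have e1 := Int.emod_add_mul_ediv (j * x) g
      have e2 : (g - j) * x = (g - (j * x) % g) + g * (x - 1 - (j * x) / g) := by
        linear_combination e1
      rw [e2, Int.add_mul_emod_self_left]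
      apply Int.emod_eq_of_lt <;> omega
    have hT : g ∣ (j * c) % g + (j * d) % g - j := by
      obtain ⟨k, hk⟩ := hcd
      have ec := Int.emod_add_mul_ediv (j * c) g
      have ed := Int.emod_add_mul_ediv (j * d) g
      exact ⟨j * k - (j * c) / g - (j * d) / g, by linear_combination ec + ed + j * hk⟩
    have hT2 : (j * c) % g + (j * d) % g = j ∨ (j * c) % g + (j * d) % g = j + g := by
      obtain ⟨k, hk⟩ := hT
      have k1 : k < 2 := by
        by_contra h
        nlinarith
      have k0 : -1 < k := by
        by_contra h
        nlinarith
      have : k = 0 ∨ k = 1 := by omega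
      rcases this with rfl | rfl
      · left; linarith
      · right; linarith
    rcases hT2 with h | h
    · left
      rcases hkey j h1 h2 hc hd with h' | h'
      · omega
      · rwa [h] at h'
    · right
      have nd : ∀ x : ℤ, ¬ g ∣ j * x → ¬ g ∣ (g - j) * x := by
        intro x hx h
        apply hx
        have := dvd_sub (dvd_mul_right g x) h
        ring_nf at this
        rwa [mul_comm] at this
      have h' := hkey (g - j) (by omega) (by omega) (nd c hc) (nd d hd)
      rw [neg c hc, neg d hd] at h'
      have e3 : g - j * c % g + (g - j * d % g) = g - j := by linarith
      rw [e3] at h'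
      rcases h' with h' | h'
      · omega
      · exact h'
  by_contra hno
  push Not at hno
  obtain ⟨hc, hd⟩ := hno
  have hg1 : 1 < g := by
    by_contra h
    have : g = 1 := by omega
    exact hc (this ▸ one_dvd c)
  have h1 : E (g - 1) ∧ 12 * g < 13 * (g - 1) := by
    rcases alt 1 le_rfl hg1 with h | h | h | h
    · rw [one_mul] at h; exact absurd h hc
    · rw [one_mul] at h; exact absurd h hd
    · omega
    · exact h
  have small : ∀ j, 2 ≤ j → j ≤ 5 → g ∣ j * c ∨ g ∣ j * d := by
    intro j hj hj5
    rcases alt j (by omega) (by omega) with h | h | h | h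
    · exact Or.inl h
    · exact Or.inr h
    · have := hE _ _ (by omega) (by omega) (by omega) (by omega) h1.1 h.1
      omega
    · have := hE _ _ (by omega) (by omega) (by omega) (by omega) h1.1 h.1
      omega
  have comb : ∀ x y z : ℤ, g ∣ x → g ∣ y → z = x - y → g ∣ z := fun x y z hx hy hz =>
    hz ▸ dvd_sub hx hy
  rcases small 2 (by norm_num) (by norm_num) with h2 | h2 <;>
  rcases small 3 (by norm_num) (by norm_num) with h3 | h3
  · exact hc (comb _ _ _ h3 h2 (by ring))
  · rcases small 5 (by norm_num) (by norm_num) with h5 | h5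
    · exact hc (comb _ _ _ h5 (h2.mul_left 2) (by ring))
    · exact hd (comb _ _ _ (h3.mul_left 2) h5 (by ring))
  · rcases small 5 (by norm_num) (by norm_num) with h5 | h5
    · exact hc (comb _ _ _ (h3.mul_left 2) h5 (by ring))
    · exact hd (comb _ _ _ h5 (h2.mul_left 2) (by ring))
  · exact hd (comb _ _ _ h3 h2 (by ring))

theorem cop1 (r a b e : ℤ) (h : r ∣ e - (a + b)) (h1 : Int.gcd a r ∣ Int.gcd e r)
    (h2 : Int.gcd a (Int.gcd b r) = 1) : Int.gcd a r = 1 := by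
  have ha : (Int.gcd a r : ℤ) ∣ a := Int.gcd_dvd_left ..
  have hr : (Int.gcd a r : ℤ) ∣ r := Int.gcd_dvd_right ..
  have he : (Int.gcd a r : ℤ) ∣ e :=
    dvd_trans (Int.natCast_dvd_natCast.2 h1) (Int.gcd_dvd_left ..)
  have hb : (Int.gcd a r : ℤ) ∣ b := by
    have := dvd_sub (dvd_sub he (dvd_trans hr h)) ha
    ring_nf at this
    exact this
  have := Int.dvd_coe_gcd ha (Int.dvd_coe_gcd hb hr)
  rw [h2] at this
  exact Nat.dvd_one.1 (by exact_mod_cast this)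

theorem fin1 (r c d e : ℤ) (h : (Int.gcd e r : ℤ) ∣ c) (h1 : Int.gcd c r ∣ Int.gcd e r)
    (h2 : Int.gcd d r ∣ Int.gcd e r)
    (h3 : Int.gcd c (Int.gcd d r) = 1) : Int.gcd e r = Int.gcd c r ∧ Int.gcd d r = 1 := by
  constructor
  · apply Nat.dvd_antisymm _ h1
    exact Int.natCast_dvd_natCast.1 (Int.dvd_coe_gcd h (Int.gcd_dvd_right ..))
  · have hc : (Int.gcd d r : ℤ) ∣ c := dvd_trans (Int.natCast_dvd_natCast.2 h2) h
    have := Int.dvd_coe_gcd hc (dvd_refl (Int.gcd d r : ℤ))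
    rw [h3] at this
    exact Nat.dvd_one.1 (by exact_mod_cast this)

/-- Proposition (xy), part (2): in the cA case, up to interchanging `z` and `t`,
`gcd(e,r) = gcd(d,r)` and `a, b, c` are coprime to `r`. -/
theorem statement8 (r : ℤ) (δ : ℝ) (a b c d e : ℤ) (S : Set (Fin 4 → ℕ))
    (B : Set (Fin 4 → ℚ))
    (hr : 13 < r) (hδ0 : 0 < δ) (hδ1 : δ ≤ 1 / 13)
    (hwt : WeightCond r a b c d e S)
    (hI : RuleI r a b c d δ S B) (hII : RuleII r a b c d e)
    (hform : FormCA S) :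
    (Int.gcd e r = Int.gcd d r ∧
      Int.gcd a r = 1 ∧ Int.gcd b r = 1 ∧ Int.gcd c r = 1) ∨
    (Int.gcd e r = Int.gcd c r ∧
      Int.gcd a r = 1 ∧ Int.gcd b r = 1 ∧ Int.gcd d r = 1) := by
  have hI' := hI
  obtain ⟨hBs, -, -, -⟩ := hI'
  obtain ⟨iia, iib, iic, iid, ab, -, -, -, -, cd, hs⟩ := hII
  have hxy : r ∣ e - (a + b) := by
    have := (hwt _ hform.1).dvd
    simpa using this
  have ha := cop1 r a b e hxy iia ab
  have hb := cop1 r b a e (by rwa [add_comm b a]) iib (by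
    rw [← Int.gcd_assoc, Int.gcd_comm b a, Int.gcd_assoc]; exact ab)
  have hgpos : 0 < (Int.gcd e r : ℤ) := by
    exact_mod_cast Int.gcd_pos_of_ne_zero_right e (by omega : r ≠ 0)
  have hge : (Int.gcd e r : ℤ) ∣ e := Int.gcd_dvd_left ..
  have hgr : (Int.gcd e r : ℤ) ∣ r := Int.gcd_dvd_right ..
  have main : (Int.gcd e r : ℤ) ∣ c ∨ (Int.gcd e r : ℤ) ∣ d := by
    generalize hG : (Int.gcd e r : ℤ) = g at *
    obtain ⟨h, hrg⟩ := hgr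
    have hh : 0 < h := by
      by_contra h0
      nlinarith
    have hcop : ∀ x : ℤ, Int.gcd x r = 1 → ∀ j, g ∣ j * x → g ∣ j := by
      intro x hx j hj
      have h1 : IsCoprime g x := by
        have : IsCoprime x r := Int.isCoprime_iff_gcd_eq_one.2 hx
        exact (IsCoprime.of_isCoprime_of_dvd_right this ⟨h, hrg⟩).symm
      exact h1.dvd_of_dvd_mul_right hj
    have nds : ∀ j, 1 ≤ j → j < g → ¬ g ∣ j := by
      intro j h1 h2 h3
      have := Int.le_of_dvd (by omega) h3
      omega
    refine core g c d (fun j => vj g a b c d j ∈ B) ?_ ?_ ?_ hgpos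
    · have h1 := dvd_trans (⟨h, hrg⟩ : g ∣ r) (dvd_sub hs.dvd hxy)
      have h2 := dvd_neg.2 h1
      have h3 : c + d - 1 = -(1 - (a + b + c + d - e) - (e - (a + b))) := by ring
      rw [h3]
      exact h2
    · intro j j' h1 h2 h3 h4 m1 m2
      have e0 := congrFun (hBs m1 m2) 0
      have hgQ : (g : ℚ) ≠ 0 := by exact_mod_cast hgpos.ne'
      simp only [vj] at e0
      rw [div_left_inj' hgQ] at e0
      have e1 : (j * a) % g = (j' * a) % g := by exact_mod_cast e0
      have e2 : g ∣ (j' - j) * a := by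
        have := Int.ModEq.dvd e1
        rwa [sub_mul]
      have e3 := hcop a ha _ e2
      have e4 := Int.eq_zero_of_abs_lt_dvd e3 (abs_lt.2 ⟨by omega, by omega⟩)
      omega
    · intro j h1 h2 hc hd
      exact key r g h δ a b c d e S B hgpos hh hrg hδ1 hwt hge hI hform j
        (fun hx => nds j h1 h2 (hcop a ha j hx)) (fun hx => nds j h1 h2 (hcop b hb j hx)) hc hd
  rcases main with h | h
  · right
    obtain ⟨h1, h2⟩ := fin1 r c d e h iic iid cd
    exact ⟨h1, ha, hb, h2⟩
  · left
    obtain ⟨h1, h2⟩ := fin1 r d c e h iid iic (by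
      rw [← Int.gcd_assoc, Int.gcd_comm d c, Int.gcd_assoc]; exact cd)
    exact ⟨h1, ha, hb, h2⟩

end GapPaper
end

section
/- There exists a real constant $\delta^*$ with $0<\delta^*\leq 1/13$ such that, in the hyperquotient setup with $\delta\leq\delta^*$, with the cA form and Rules I and II, the following holds: if $B=\{\beta\}$ and $\beta\in N\cap\square$, then there exists an integer $k_0$ with $1\leq k_0\leq r-1$ such that $\beta=\alpha_{k_0}$, $\overline{ak_0}+\overline{bk_0}=\overline{ek_0}+r$, $\overline{ck_0}+\overline{dk_0}=k_0$, and $1-\delta<\frac{k_0}{r}<1$. -/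
open scoped BigOperators

namespace GapPaper

theorem cell {p q : ℚ} (hp : 0 ≤ p) (hq : 0 ≤ q) (hp1 : p < 1) (hq1 : q < 1) (j : ℕ) (hj : 0 < j)
    (h : 1 ≤ Int.fract ((j : ℚ) * p) + Int.fract ((j : ℚ) * q)) :
    ∃ s t : ℕ, s < j ∧ t < j ∧ (s : ℚ) ≤ j * p ∧ (j : ℚ) * p < s + 1 ∧ (t : ℚ) ≤ j * q ∧
      (j : ℚ) * q < t + 1 ∧ (s : ℚ) + t + 1 ≤ j * p + j * q := by
  have hj' : (0 : ℚ) < j := by exact_mod_cast hj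
  have key : ∀ x : ℚ, 0 ≤ x → x < 1 → ∃ s : ℕ, s < j ∧ (s : ℚ) ≤ j * x ∧ (j : ℚ) * x < s + 1 ∧
      Int.fract ((j : ℚ) * x) = j * x - s := by
    intro x h0 h1
    have hn : 0 ≤ (j : ℚ) * x := by positivity
    refine ⟨⌊(j : ℚ) * x⌋₊, ?_, Nat.floor_le hn, Nat.lt_floor_add_one _, ?_⟩
    · rw [Nat.floor_lt hn]; nlinarith
    · have h2 : ((⌊(j : ℚ) * x⌋₊ : ℕ) : ℚ) = ((⌊(j : ℚ) * x⌋ : ℤ) : ℚ) := by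
        rw [← Int.natCast_floor_eq_floor hn]; simp
      rw [h2]; rfl
  obtain ⟨s, a1, a2, a3, a4⟩ := key p hp hp1
  obtain ⟨t, b1, b2, b3, b4⟩ := key q hq hq1
  exact ⟨s, t, a1, b1, a2, a3, b2, b3, by linarith⟩

set_option maxHeartbeats 1000000 in
theorem box2 {p q : ℚ} (hp : 0 ≤ p) (hq : 0 ≤ q) (h1 : p + q < 1)
    (H : ∀ j : ℕ, j ∈ [3, 5] → 1 ≤ Int.fract ((j : ℚ) * p) + Int.fract ((j : ℚ) * q)) :
    1 / 15 ≤ p ∧ 1 / 15 ≤ q ∧ p + q ≤ 14 / 15 := by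
  have K : ∀ j : ℕ, 0 < j → j ∈ [3, 5] → _ := fun j hj h =>
    cell hp hq (by linarith) (by linarith) j hj (H j h)
  clear H
  all_goals
    obtain ⟨s, t, hs, ht, a1, a2, a3, a4, a5⟩ := K 3 (by norm_num) (by decide)
    push_cast at a1 a2 a3 a4 a5
    interval_cases s <;> interval_cases t <;> push_cast at a1 a2 a3 a4 a5 <;> try (exfalso; linarith)
  all_goals
    obtain ⟨s, t, hs, ht, a1, a2, a3, a4, a5⟩ := K 5 (by norm_num) (by decide)
    push_cast at a1 a2 a3 a4 a5
    interval_cases s <;> interval_cases t <;> push_cast at a1 a2 a3 a4 a5 <;> try (exfalso; linarith)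
  all_goals exact ⟨by linarith, by linarith, by linarith⟩

set_option maxHeartbeats 1000000 in
theorem box3 {p q : ℚ} (hp : 0 ≤ p) (hq : 0 ≤ q) (h1 : p + q < 1)
    (H : ∀ j : ℕ, j ∈ [2, 5] → 1 ≤ Int.fract ((j : ℚ) * p) + Int.fract ((j : ℚ) * q)) :
    1 / 15 ≤ p ∧ 1 / 15 ≤ q ∧ p + q ≤ 14 / 15 := by
  have K : ∀ j : ℕ, 0 < j → j ∈ [2, 5] → _ := fun j hj h =>
    cell hp hq (by linarith) (by linarith) j hj (H j h)
  clear H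
  all_goals
    obtain ⟨s, t, hs, ht, a1, a2, a3, a4, a5⟩ := K 2 (by norm_num) (by decide)
    push_cast at a1 a2 a3 a4 a5
    interval_cases s <;> interval_cases t <;> push_cast at a1 a2 a3 a4 a5 <;> try (exfalso; linarith)
  all_goals
    obtain ⟨s, t, hs, ht, a1, a2, a3, a4, a5⟩ := K 5 (by norm_num) (by decide)
    push_cast at a1 a2 a3 a4 a5
    interval_cases s <;> interval_cases t <;> push_cast at a1 a2 a3 a4 a5 <;> try (exfalso; linarith)
  all_goals exact ⟨by linarith, by linarith, by linarith⟩

set_option maxHeartbeats 1000000 in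
theorem box5 {p q : ℚ} (hp : 0 ≤ p) (hq : 0 ≤ q) (h1 : p + q < 1)
    (H : ∀ j : ℕ, j ∈ [2, 3] → 1 ≤ Int.fract ((j : ℚ) * p) + Int.fract ((j : ℚ) * q)) :
    1 / 15 ≤ p ∧ 1 / 15 ≤ q ∧ p + q ≤ 14 / 15 := by
  have K : ∀ j : ℕ, 0 < j → j ∈ [2, 3] → _ := fun j hj h =>
    cell hp hq (by linarith) (by linarith) j hj (H j h)
  clear H
  all_goals
    obtain ⟨s, t, hs, ht, a1, a2, a3, a4, a5⟩ := K 2 (by norm_num) (by decide)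
    push_cast at a1 a2 a3 a4 a5
    interval_cases s <;> interval_cases t <;> push_cast at a1 a2 a3 a4 a5 <;> try (exfalso; linarith)
  all_goals
    obtain ⟨s, t, hs, ht, a1, a2, a3, a4, a5⟩ := K 3 (by norm_num) (by decide)
    push_cast at a1 a2 a3 a4 a5
    interval_cases s <;> interval_cases t <;> push_cast at a1 a2 a3 a4 a5 <;> try (exfalso; linarith)
  all_goals exact ⟨by linarith, by linarith, by linarith⟩


theorem dirich (x y : ℚ) : ∃ m : ℕ, 1 ≤ m ∧ m ≤ 961 ∧ ∃ u v : ℤ,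
    |(m : ℚ) * x - u| < 1 / 31 ∧ |(m : ℚ) * y - v| < 1 / 31 := by
  have hfl : ∀ z : ℚ, ⌊31 * Int.fract z⌋₊ < 31 := by
    intro z
    have h0 := Int.fract_nonneg z
    have h1 := Int.fract_lt_one z
    rw [Nat.floor_lt (by positivity)]
    push_cast; linarith
  have hclose : ∀ z z' : ℚ, ⌊31 * Int.fract z⌋₊ = ⌊31 * Int.fract z'⌋₊ →
      |Int.fract z' - Int.fract z| < 1 / 31 := by
    intro z z' h
    have h0 := Int.fract_nonneg z
    have h0' := Int.fract_nonneg z'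
    have a1 := Nat.floor_le (show 0 ≤ 31 * Int.fract z by positivity)
    have a2 := Nat.lt_floor_add_one (31 * Int.fract z)
    have b1 := Nat.floor_le (show 0 ≤ 31 * Int.fract z' by positivity)
    have b2 := Nat.lt_floor_add_one (31 * Int.fract z')
    rw [h] at a1 a2
    rw [abs_lt]
    constructor <;> linarith
  have key : ∃ a b : ℕ, a < b ∧ b ≤ 961 ∧
      ⌊31 * Int.fract ((a : ℚ) * x)⌋₊ = ⌊31 * Int.fract ((b : ℚ) * x)⌋₊ ∧
      ⌊31 * Int.fract ((a : ℚ) * y)⌋₊ = ⌊31 * Int.fract ((b : ℚ) * y)⌋₊ := by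
    obtain ⟨a, ha, b, hb, hab, he⟩ := Finset.exists_ne_map_eq_of_card_lt_of_maps_to
      (s := Finset.range 962) (t := Finset.range 31 ×ˢ Finset.range 31)
      (f := fun n : ℕ => (⌊31 * Int.fract ((n : ℚ) * x)⌋₊, ⌊31 * Int.fract ((n : ℚ) * y)⌋₊))
      (by simp) (by
        intro n hn
        simp only [Finset.coe_product, Finset.coe_range, Set.mem_prod, Set.mem_Iio]
        exact ⟨hfl _, hfl _⟩)
    simp only [Prod.mk.injEq, Finset.mem_range] at he ha hb
    rcases lt_or_gt_of_ne hab with h | h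
    · exact ⟨a, b, h, by omega, he.1, he.2⟩
    · exact ⟨b, a, h, by omega, he.1.symm, he.2.symm⟩
  obtain ⟨a, b, hab, hb, hx, hy⟩ := key
  refine ⟨b - a, by omega, by omega, ⌊(b : ℚ) * x⌋ - ⌊(a : ℚ) * x⌋, ⌊(b : ℚ) * y⌋ - ⌊(a : ℚ) * y⌋,
    ?_, ?_⟩
  · have := hclose _ _ hx
    rw [Nat.cast_sub hab.le]
    push_cast
    simp only [Int.fract] at this
    convert this using 2
    ring
  · have := hclose _ _ hy
    rw [Nat.cast_sub hab.le]
    push_cast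
    simp only [Int.fract] at this
    convert this using 2
    ring

theorem recur {p q : ℚ} (hp : 1 / 15 ≤ p) (hq : 1 / 15 ≤ q) (h : p + q ≤ 14 / 15) (n : ℕ) :
    ∃ m : ℕ, 1 ≤ m ∧ m ≤ 961 ∧
      Int.fract (((1 + n * m : ℕ) : ℚ) * p) + Int.fract (((1 + n * m : ℕ) : ℚ) * q) < 1 := by
  obtain ⟨m, h1, h2, u, v, hu, hv⟩ := dirich (n * p) (n * q)
  refine ⟨m, h1, h2, ?_⟩
  rw [abs_lt] at hu hv
  have e1 : Int.fract (((1 + n * m : ℕ) : ℚ) * p) = p + (m * (n * p) - u) := by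
    rw [Int.fract_eq_iff]
    refine ⟨by linarith, by linarith, u, by push_cast; ring⟩
  have e2 : Int.fract (((1 + n * m : ℕ) : ℚ) * q) = q + (m * (n * q) - v) := by
    rw [Int.fract_eq_iff]
    refine ⟨by linarith, by linarith, v, by push_cast; ring⟩
  rw [e1, e2]
  linarith

theorem badprime {z l : ℚ} (hz : 0 ≤ z) (hl : 0 < l) (hzl : z ≤ 1 - l)
    (hs : l ≤ 1 / 10 ^ 13) :
    ∃ π : ℕ, π.Prime ∧ ∀ j : ℕ, 1 ≤ j → j ≤ 10 ^ 6 →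
      1 - (j : ℚ) * l < Int.fract ((j : ℚ) * z) → π ∣ j := by
  by_cases hex : ∃ j : ℕ, 1 ≤ j ∧ j ≤ 10 ^ 6 ∧ 1 - (j : ℚ) * l < Int.fract ((j : ℚ) * z)
  swap
  · refine ⟨2, Nat.prime_two, fun j h1 h2 h3 => (hex ⟨j, h1, h2, h3⟩).elim⟩
  have key : ∀ j : ℕ, 1 - (j : ℚ) * l < Int.fract ((j : ℚ) * z) →
      ∃ h : ℕ, (j : ℚ) * z < h ∧ (h : ℚ) < j * z + j * l := by
    intro j hj
    have hn : 0 ≤ (j : ℚ) * z := by positivity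
    refine ⟨⌊(j : ℚ) * z⌋₊ + 1, ?_, ?_⟩
    · push_cast; exact Nat.lt_floor_add_one _
    · have h2 : ((⌊(j : ℚ) * z⌋₊ : ℕ) : ℚ) = ((⌊(j : ℚ) * z⌋ : ℤ) : ℚ) := by
        rw [← Int.natCast_floor_eq_floor hn]; simp
      push_cast
      rw [h2]
      simp only [Int.fract] at hj
      linarith
  obtain ⟨j0, h1, h2, h3⟩ := hex
  obtain ⟨h0, ha, hb⟩ := key j0 h3
  have hj0 : (0 : ℚ) < j0 := by exact_mod_cast h1
  obtain ⟨u, v, hcop, hu, hv⟩ := Nat.exists_coprime h0 j0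
  set g := Nat.gcd h0 j0 with hg
  have hgpos : 0 < g := Nat.gcd_pos_of_pos_right _ h1
  have hv1 : v ≠ 1 := by
    rintro rfl
    have e1 : j0 = g := by omega
    have e2 : h0 = u * j0 := by rw [hu]; congr 1; exact e1.symm
    rw [e2] at ha hb
    push_cast at ha hb
    have c1 : z < u := by nlinarith
    have c2 : (u : ℚ) < z + l := by nlinarith
    have c3 : (u : ℚ) < 1 := by linarith
    have c4 : u < 1 := by exact_mod_cast c3
    have c5 : u = 0 := by omega
    rw [c5] at c1
    push_cast at c1
    linarith
  refine ⟨v.minFac, Nat.minFac_prime hv1, ?_⟩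
  intro j k1 k2 k3
  obtain ⟨h, hc, hd⟩ := key j k3
  have hj : (0 : ℚ) < j := by exact_mod_cast k1
  have hjj : (j : ℚ) * j0 * l < 1 := by
    have t1 : (j : ℚ) ≤ 10 ^ 6 := by exact_mod_cast k2
    have t2 : (j0 : ℚ) ≤ 10 ^ 6 := by exact_mod_cast h2
    have t3 : (j : ℚ) * j0 ≤ 10 ^ 6 * 10 ^ 6 := by gcongr
    have t4 : (j : ℚ) * j0 * l ≤ (10 ^ 6 * 10 ^ 6) * (1 / 10 ^ 13) := by gcongr
    norm_num at t4
    linarith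
  have hEq : h * j0 = h0 * j := by
    have i1 : (h : ℚ) * j0 - h0 * j < 1 := by nlinarith
    have i2 : (h0 : ℚ) * j - h * j0 < 1 := by nlinarith
    have i1' : (h : ℤ) * j0 - h0 * j < 1 := by exact_mod_cast i1
    have i2' : (h0 : ℤ) * j - h * j0 < 1 := by exact_mod_cast i2
    have : (h : ℤ) * j0 = h0 * j := by omega
    exact_mod_cast this
  have hEq2 : h * v = u * j := by
    have : (h * v) * g = (u * j) * g := by
      calc (h * v) * g = h * (v * g) := by ring
        _ = h0 * j := by rw [← hv, hEq]
        _ = (u * g) * j := by rw [← hu]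
        _ = _ := by ring
    exact Nat.eq_of_mul_eq_mul_right hgpos this
  have : v ∣ u * j := ⟨h, by rw [← hEq2]; ring⟩
  exact (Nat.minFac_dvd v).trans ((Nat.Coprime.symm hcop).dvd_of_dvd_mul_left this)

theorem core_s9 {p q z l : ℚ} (hp : 0 ≤ p) (hq : 0 ≤ q) (hpq : p + q < 1)
    (hz : 0 ≤ z) (hl : 0 < l) (hzl : z ≤ 1 - l) (hs : l ≤ 1 / 10 ^ 13)
    (H : ∀ j : ℕ, 2 ≤ j → j ≤ 10 ^ 6 → Int.fract ((j : ℚ) * z) ≤ 1 - (j : ℚ) * l →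
      1 ≤ Int.fract ((j : ℚ) * p) + Int.fract ((j : ℚ) * q)) : False := by
  obtain ⟨π, hπ, hbad⟩ := badprime hz hl hzl hs
  have H' : ∀ j : ℕ, 2 ≤ j → j ≤ 10 ^ 6 → ¬ π ∣ j →
      1 ≤ Int.fract ((j : ℚ) * p) + Int.fract ((j : ℚ) * q) := by
    intro j h1 h2 h3
    apply H j h1 h2
    by_contra hcon
    exact h3 (hbad j (by omega) h2 (not_le.mp hcon))
  have hbox : 1 / 15 ≤ p ∧ 1 / 15 ≤ q ∧ p + q ≤ 14 / 15 := by
    by_cases h2 : π = 2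
    · subst h2
      apply box2 hp hq hpq
      intro j hj
      simp only [List.mem_cons, List.not_mem_nil, or_false] at hj
      rcases hj with rfl | rfl <;> exact H' _ (by norm_num) (by norm_num) (by norm_num)
    by_cases h3 : π = 3
    · subst h3
      apply box3 hp hq hpq
      intro j hj
      simp only [List.mem_cons, List.not_mem_nil, or_false] at hj
      rcases hj with rfl | rfl <;> exact H' _ (by norm_num) (by norm_num) (by norm_num)
    · apply box5 hp hq hpq
      intro j hj
      simp only [List.mem_cons, List.not_mem_nil, or_false] at hj
      have hπ2 := hπ.two_le
      rcases hj with rfl | rfl <;> refine H' _ (by norm_num) (by norm_num) (fun hd => ?_)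
      · have := Nat.le_of_dvd (by norm_num) hd; omega
      · have := Nat.le_of_dvd (by norm_num) hd; omega
  obtain ⟨b1, b2, b3⟩ := hbox
  by_cases hle : π ≤ 962
  · obtain ⟨m, m1, m2, m3⟩ := recur b1 b2 b3 π
    have hm : π * m ≤ 962 * 961 := Nat.mul_le_mul hle m2
    have hm' : 1 ≤ π * m := Nat.mul_pos hπ.pos m1
    have := H' (1 + π * m) (by omega) (by omega) (fun hd => by
      have h1 : π ∣ 1 := (Nat.dvd_add_left (Nat.dvd_mul_right π m)).mp hd
      exact hπ.one_lt.ne' (Nat.dvd_one.mp h1))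
    linarith
  · obtain ⟨m, m1, m2, m3⟩ := recur b1 b2 b3 1
    have := H' (1 + 1 * m) (by omega) (by omega) (fun hd => by
      have := Nat.le_of_dvd (by omega) hd
      omega)
    linarith

/-- The value `vf S v` differs from `v 0 + v 1` by a non-negative integer. -/
theorem vf_val {r a b c d e : ℤ} (hr : 13 < r) {S : Set (Fin 4 → ℕ)}
    (hW : WeightCond r a b c d e S) (hF : FormCA S) {v : Fin 4 → ℚ}
    (hv : v ∈ latN r a b c d) (ho : v ∈ orth) :
    ∃ t : ℤ, 0 ≤ t ∧ vf S v = ((v 0 + v 1 : ℚ) : ℝ) - t ∧ (t : ℚ) ≤ v 0 + v 1 := by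
  obtain ⟨j, n, hn⟩ := hv
  have hr0 : (r : ℚ) ≠ 0 := by
    have : r ≠ 0 := by omega
    exact_mod_cast this
  have hab := hW _ hF.1
  have hint : ∀ m ∈ S, ∃ t : ℤ, ∑ i : Fin 4, (m i : ℚ) * v i = v 0 + v 1 + t := by
    intro m hm
    have h1 := (hW m hm).trans hab.symm
    obtain ⟨s, hs⟩ := h1.symm.dvd
    simp at hs
    have hs' : (m 0 : ℚ) * a + m 1 * b + m 2 * c + m 3 * d - (a + b) = r * s := by
      exact_mod_cast hs
    refine ⟨j * s + m 0 * n 0 + m 1 * n 1 + m 2 * n 2 + m 3 * n 3 - n 0 - n 1, ?_⟩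
    rw [Fin.sum_univ_four, hn 0, hn 1, hn 2, hn 3]
    simp
    have hs2 : (s : ℚ) = ((m 0 : ℚ) * a + m 1 * b + m 2 * c + m 3 * d - (a + b)) / r := by
      rw [hs']; field_simp
    rw [hs2]
    field_simp
    ring
  have hnn : ∀ m : Fin 4 → ℕ, 0 ≤ ∑ i : Fin 4, (m i : ℚ) * v i := fun m =>
    Finset.sum_nonneg fun i _ => mul_nonneg (Nat.cast_nonneg _) (ho i)
  obtain ⟨t0, ⟨m0, hm0, ht0⟩, hleast⟩ := Int.exists_least_of_bdd
    (P := fun t : ℤ => ∃ m ∈ S, ∑ i : Fin 4, (m i : ℚ) * v i = v 0 + v 1 + t)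
    ⟨⌊-(v 0 + v 1)⌋, by
      rintro t ⟨m, hm, h⟩
      have := hnn m
      have h2 : -(v 0 + v 1) ≤ t := by linarith
      have h3 := (Int.floor_le (-(v 0 + v 1))).trans h2
      exact_mod_cast h3⟩
    (by
      obtain ⟨t, ht⟩ := hint _ hF.1
      exact ⟨t, _, hF.1, ht⟩)
  have h0 : t0 ≤ 0 := hleast 0 ⟨_, hF.1, by simp [Fin.sum_univ_four]⟩
  refine ⟨-t0, by omega, ?_, ?_⟩
  · unfold vf
    apply IsLeast.csInf_eq
    constructor
    · refine ⟨m0, hm0, ?_⟩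
      have : ((∑ i : Fin 4, (m0 i : ℚ) * v i : ℚ) : ℝ) = ((v 0 + v 1 + t0 : ℚ) : ℝ) := by rw [ht0]
      push_cast at this ⊢
      linarith
    · rintro x ⟨m, hm, rfl⟩
      obtain ⟨t, ht⟩ := hint m hm
      have hle : t0 ≤ t := hleast t ⟨m, hm, ht⟩
      have hle' : (t0 : ℝ) ≤ t := by exact_mod_cast hle
      have : ((∑ i : Fin 4, (m i : ℚ) * v i : ℚ) : ℝ) = ((v 0 + v 1 + t : ℚ) : ℝ) := by rw [ht]
      push_cast at this ⊢
      linarith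
  · have := hnn m0
    push_cast
    linarith

theorem res_of {r a j m : ℤ} (hr : 13 < r) {x : ℚ} (h : x = ((j * a : ℤ) : ℚ) / r + m)
    (h0 : 0 ≤ x) (h1 : x < 1) : x = ((res r (a * (j % r)) : ℤ) : ℚ) / r := by
  have hr0 : (0 : ℚ) < r := by
    have : 0 < r := by omega
    exact_mod_cast this
  have hx : x * r = ((j * a + m * r : ℤ) : ℚ) := by
    rw [h]; push_cast; field_simp
  have b0 : 0 ≤ j * a + m * r := by
    have : (0 : ℚ) ≤ ((j * a + m * r : ℤ) : ℚ) := by rw [← hx]; positivity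
    exact_mod_cast this
  have b1 : j * a + m * r < r := by
    have : ((j * a + m * r : ℤ) : ℚ) < r := by rw [← hx]; nlinarith
    exact_mod_cast this
  have e : res r (a * (j % r)) = j * a + m * r := by
    unfold res
    rw [← Int.emod_eq_of_lt b0 b1]
    rw [Int.add_mul_emod_self_right, mul_comm j a, Int.mul_emod a (j % r), Int.emod_emod, ← Int.mul_emod]
  rw [e, ← hx]
  field_simp

theorem lat_comb {r a b c d : ℤ} {v : Fin 4 → ℚ} (hv : v ∈ latN r a b c d) (n : ℤ)
    (u : Fin 4 → ℚ) (k : Fin 4 → ℤ) (hu : ∀ i, u i = n * v i + k i) : u ∈ latN r a b c d := by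
  obtain ⟨j, m, hm⟩ := hv
  refine ⟨n * j, fun i => n * m i + k i, fun i => ?_⟩
  rw [hu, hm i]
  push_cast
  ring

/-- Proposition (xy), part (3): in the cA case, if `B = {β}` with `β` in the
punctured cube, then `β = α_{k_0}` for some `k_0` with the stated properties. -/
theorem statement9 :
    ∃ δstar : ℝ, 0 < δstar ∧ δstar ≤ 1 / 13 ∧
      ∀ (r : ℤ) (δ : ℝ) (a b c d e : ℤ) (S : Set (Fin 4 → ℕ)) (B : Set (Fin 4 → ℚ)),
        13 < r → 0 < δ → δ ≤ δstar →
        WeightCond r a b c d e S → RuleI r a b c d δ S B → RuleII r a b c d e →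
        FormCA S →
        ∀ β, B = {β} → β ∈ latN r a b c d ∩ cube →
        ∃ k0 : ℤ, 1 ≤ k0 ∧ k0 ≤ r - 1 ∧ β = alphaK r a b c d k0 ∧
          res r (a * k0) + res r (b * k0) = res r (e * k0) + r ∧
          res r (c * k0) + res r (d * k0) = k0 ∧
          1 - δ < (k0 : ℝ) / (r : ℝ) ∧ (k0 : ℝ) / (r : ℝ) < 1 := by
  refine ⟨1 / 10 ^ 13, by positivity, by norm_num, ?_⟩
  intro r δ a b c d e S B hr hδ0 hδ hW hI hII hF β hB hβ
  subst hB
  obtain ⟨hβN, hβ01, -⟩ := hβ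
  obtain ⟨-, hsub, hbeta, hrest⟩ := hI
  have hβo : β ∈ orth := (hsub rfl).2
  obtain ⟨-, hlo, hhi⟩ := hbeta β rfl
  have hrq : (0 : ℚ) < r := by
    have : 0 < r := by omega
    exact_mod_cast this
  -- lower and upper bounds for `β 2 + β 3`
  obtain ⟨t, ht0, htv, -⟩ := vf_val hr hW hF hβN hβo
  have hw : w β = β 0 + β 1 + (β 2 + β 3) := by
    unfold w; rw [Fin.sum_univ_four]; ring
  rw [htv, hw] at hlo hhi
  push_cast at hlo hhi
  have hs0 : 0 ≤ β 2 + β 3 := add_nonneg (hβo 2) (hβo 3)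
  have hs0' : (0 : ℝ) ≤ (β 2 : ℝ) + β 3 := by exact_mod_cast hs0
  have htz : t = 0 := by
    have : (t : ℝ) < 1 := by linarith
    have : t < 1 := by exact_mod_cast this
    omega
  subst htz
  have hup : β 2 + β 3 < 1 := by
    have : (β 2 : ℝ) + β 3 < 1 := by push_cast at hhi; linarith
    exact_mod_cast this
  have hlow : 1 - δ < (β 2 : ℝ) + β 3 := by push_cast at hlo; linarith
  have hlowq : 1 - 1 / 10 ^ 13 < β 2 + β 3 := by
    have : (1 : ℝ) - 1 / 10 ^ 13 < (β 2 : ℝ) + β 3 := by linarith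
    have h2 : ((1 - 1 / 10 ^ 13 : ℚ) : ℝ) < ((β 2 + β 3 : ℚ) : ℝ) := by push_cast; exact this
    exact Rat.cast_lt.mp h2
  have hup3 : β 2 < 1 := by have := hβo 3; linarith
  have hup4 : β 3 < 1 := by have := hβo 2; linarith
  -- the general rule
  have R : ∀ v ∈ latN r a b c d, v ∈ orth → 0 < v 2 + v 3 → v 2 + v 3 < 1 → v ≠ β →
      1 ≤ v 0 + v 1 := by
    intro v hvN hvo h0 h1 hne
    have hc : v ∉ corners := by
      rintro (h | ⟨i, h⟩)
      · rw [h] at h0; simp at h0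
      · rw [h] at h0 h1
        fin_cases i <;> simp at h0 h1
    have h := hrest v ⟨hvN, hvo⟩ hne hc
    obtain ⟨t, ht0, htv, htl⟩ := vf_val hr hW hF hvN hvo
    have hw : w v = v 0 + v 1 + (v 2 + v 3) := by
      unfold w; rw [Fin.sum_univ_four]; ring
    rw [htv, hw] at h
    push_cast at h
    have h1' : (v 2 : ℝ) + v 3 < 1 := by exact_mod_cast h1
    have : (0 : ℝ) < t := by linarith
    have h3 : 0 < t := by exact_mod_cast this
    have h4 : (1 : ℚ) ≤ t := by exact_mod_cast h3
    linarith
  have hlam : 0 < β 2 + β 3 := by norm_num at hlowq; linarith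
  have hβ0 : β 0 < 1 := by
    by_contra hcon
    have h1 : β 0 = 1 := le_antisymm (hβ01 0).2 (not_lt.mp hcon)
    have := R ![0, Int.fract (β 1), β 2, β 3]
      (lat_comb hβN 1 _ ![-1, -⌊β 1⌋, 0, 0] (by
        intro i; fin_cases i <;> simp [h1, -Int.self_sub_floor]; simp only [Int.fract]; ring))
      (by intro i; fin_cases i <;> simp [Int.fract_nonneg]; exacts [hβo 2, hβo 3])
      (by simpa using hlam) (by simpa using hup)
      (by intro h; have := congrFun h 0; simp [h1] at this)
    simp at this
    have h2 := Int.fract_lt_one (β 1)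
    linarith
  have hβ1 : β 1 < 1 := by
    by_contra hcon
    have h1 : β 1 = 1 := le_antisymm (hβ01 1).2 (not_lt.mp hcon)
    have := R ![Int.fract (β 0), 0, β 2, β 3]
      (lat_comb hβN 1 _ ![-⌊β 0⌋, -1, 0, 0] (by
        intro i; fin_cases i <;> simp [h1, -Int.self_sub_floor]; simp only [Int.fract]; ring))
      (by intro i; fin_cases i <;> simp [Int.fract_nonneg]; exacts [hβo 2, hβo 3])
      (by simpa using hlam) (by simpa using hup)
      (by intro h; have := congrFun h 1; simp [h1] at this)
    simp at this
    have h2 := Int.fract_lt_one (β 0)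
    linarith
  -- the main inequality
  have hmain : 1 ≤ β 0 + β 1 := by
    by_contra hcon
    refine core_s9 (p := β 0) (q := β 1) (z := β 2) (l := 1 - (β 2 + β 3)) (hβo 0) (hβo 1)
      (not_le.mp hcon) (hβo 2) (by linarith) (by have := hβo 3; linarith) (by linarith) ?_
    intro j h2 hj6 hz
    have hj2 : (2 : ℚ) ≤ j := by exact_mod_cast h2
    have hj6' : (j : ℚ) ≤ 10 ^ 6 := by exact_mod_cast hj6
    have hjl : (j : ℚ) * (1 - (β 2 + β 3)) < 1 := by
      have : (j : ℚ) * (1 - (β 2 + β 3)) ≤ 10 ^ 6 * (1 / 10 ^ 13) := by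
        apply mul_le_mul hj6' (by linarith) (by linarith) (by positivity)
      norm_num at this
      linarith
    have hjl' : 1 - (β 2 + β 3) < (j : ℚ) * (1 - (β 2 + β 3)) := by nlinarith
    have := R ![Int.fract (j * β 0), Int.fract (j * β 1), Int.fract (j * β 2),
        1 - j * (1 - (β 2 + β 3)) - Int.fract (j * β 2)]
      (lat_comb hβN j _ ![-⌊j * β 0⌋, -⌊j * β 1⌋, -⌊j * β 2⌋, 1 - j + ⌊j * β 2⌋] (by
        intro i; fin_cases i <;> simp [-Int.self_sub_floor] <;> simp only [Int.fract] <;> ring))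
      (by intro i; fin_cases i <;> simp [Int.fract_nonneg]; linarith)
      (by simp; linarith) (by simp; linarith)
      (by
        intro h
        have e2 := congrFun h 2
        have e3 := congrFun h 3
        simp at e2 e3
        linarith)
    simpa using this
  -- conclusion
  obtain ⟨j, m, hm⟩ := hβN
  have e0 := res_of hr (hm 0) (hβo 0) hβ0
  have e1 := res_of hr (hm 1) (hβo 1) hβ1
  have e2 := res_of hr (hm 2) (hβo 2) hup3
  have e3 := res_of hr (hm 3) (hβo 3) hup4
  simp only [Matrix.cons_val] at e0 e1 e2 e3
  have hab : a + b ≡ e [ZMOD r] := by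
    have := hW _ hF.1
    simpa using this
  have hcd : c + d ≡ 1 [ZMOD r] := by
    have h := hII.2.2.2.2.2.2.2.2.2.2
    have h2 : a + b + c + d - e - (a + b - e) ≡ 1 - (e - e) [ZMOD r] :=
      h.sub (hab.sub_right e)
    have h3 : a + b + c + d - e - (a + b - e) = c + d := by ring
    rwa [h3, sub_self, sub_zero] at h2
  set k := j % r with hk
  have hk0 : 0 ≤ k := Int.emod_nonneg _ (by omega)
  have hk1 : k < r := Int.emod_lt_of_pos _ (by omega)
  have hmodr : ∀ x : ℤ, res r x ≡ x [ZMOD r] := fun x => Int.mod_modEq x r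
  have hb : ∀ x : ℤ, 0 ≤ res r x ∧ res r x < r := fun x =>
    ⟨Int.emod_nonneg _ (by omega), Int.emod_lt_of_pos _ (by omega)⟩
  have hCD1 : res r (c * k) + res r (d * k) < r := by
    rw [e2, e3, ← add_div, div_lt_one hrq] at hup
    exact_mod_cast hup
  have hCD : res r (c * k) + res r (d * k) = k := by
    have h1 : res r (c * k) + res r (d * k) ≡ k [ZMOD r] := by
      have h2 := (hmodr (c * k)).add (hmodr (d * k))
      rw [← add_mul] at h2
      simpa using h2.trans (hcd.mul_right k)
    have h3 := h1.eq
    rwa [Int.emod_eq_of_lt (by have := hb (c * k); have := hb (d * k); omega) hCD1,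
      Int.emod_eq_of_lt hk0 hk1] at h3
  have hAB1 : r ≤ res r (a * k) + res r (b * k) := by
    rw [e0, e1, ← add_div, le_div_iff₀ hrq, one_mul] at hmain
    exact_mod_cast hmain
  have hAB : res r (a * k) + res r (b * k) = res r (e * k) + r := by
    have h1 : res r (a * k) + res r (b * k) - r ≡ res r (e * k) [ZMOD r] := by
      have h2 := (hmodr (a * k)).add (hmodr (b * k))
      rw [← add_mul] at h2
      have h4 := (h2.trans (hab.mul_right k)).trans (hmodr (e * k)).symm
      have h5 := h4.sub (show r ≡ 0 [ZMOD r] by simp [Int.ModEq])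
      simpa using h5
    have h3 := h1.eq
    have ba := hb (a * k)
    have bb := hb (b * k)
    have be := hb (e * k)
    rw [Int.emod_eq_of_lt (by omega) (by omega), Int.emod_eq_of_lt be.1 be.2] at h3
    omega
  have hsum : β 2 + β 3 = (k : ℚ) / r := by
    rw [e2, e3, ← add_div]
    congr 1
    exact_mod_cast hCD
  have hsumR : (β 2 : ℝ) + β 3 = (k : ℝ) / r := by exact_mod_cast hsum
  have hkne : k ≠ 0 := by
    intro h
    rw [hsum, h] at hlam
    simp at hlam
  refine ⟨k, by omega, by omega, ?_, hAB, hCD, by rw [← hsumR]; exact hlow, ?_⟩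
  · funext i
    unfold alphaK
    fin_cases i
    · simpa using e0
    · simpa using e1
    · simpa using e2
    · simpa using e3
  · rw [← hsumR]; exact_mod_cast hup

end GapPaper
end

section
/- There exists a real constant $\delta^*$ with $0<\delta^*\leq 1/13$ such that, in the hyperquotient setup with $\delta\leq\delta^*$, with the cA form and Rules I and II, for every integer $k$ with $1\leq k\leq r-1$ one has $\overline{ak}+\overline{bk}+\overline{ck}+\overline{dk}=\overline{ek}+k+r$. -/
open scoped BigOperators

namespace GapPaper

theorem Dir (K : ℕ) (hK : 0 < K) : ∃ M : ℕ, ∀ x y z : ℝ, ∃ n : ℕ, 0 < n ∧ n ≤ M ∧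
    ∃ p q l : ℤ, |n * x - p| ≤ 1 / (K:ℝ) ∧ |n * y - q| ≤ 1 / (K:ℝ) ∧ |n * z - l| ≤ 1 / (K:ℝ) := by
  refine ⟨K * (K * K) * (K * K * (K * K)), fun x y z => ?_⟩
  have hKR : (0:ℝ) < K := by exact_mod_cast hK
  obtain ⟨n1, h1, h1', h1''⟩ := Real.exists_nat_abs_mul_sub_round_le x
    (show 0 < K * K * (K * K) by positivity)
  obtain ⟨n2, h2, h2', h2''⟩ := Real.exists_nat_abs_mul_sub_round_le (n1 * y)
    (show 0 < K * K by positivity)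
  obtain ⟨n3, h3, h3', h3''⟩ := Real.exists_nat_abs_mul_sub_round_le (n2 * n1 * z) hK
  have aux : ∀ (w : ℝ) (P : ℤ) (n T : ℕ), |w - P| ≤ 1 / (T + 1 : ℝ) → 0 < T → n * K ≤ T →
      |n * w - (n * P : ℤ)| ≤ 1 / (K:ℝ) := by
    intro w P n T h hT hn
    have e : (n:ℝ) * w - ((n * P : ℤ) : ℝ) = n * (w - P) := by push_cast; ring
    rw [e, abs_mul, Nat.abs_cast]
    have hn' : (n:ℝ) * K ≤ T := by exact_mod_cast hn
    have hT' : (0:ℝ) < T := by exact_mod_cast hT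
    calc (n:ℝ) * |w - P| ≤ n * (1 / (T+1)) := by gcongr
      _ ≤ 1 / K := by
        rw [mul_one_div, div_le_div_iff₀ (by linarith) hKR]; linarith
  have a1 := aux _ _ (n3 * n2) (K * K * (K * K)) (by push_cast at h1'' ⊢; exact h1'') (by positivity)
    (by nlinarith [Nat.mul_le_mul h3' h2', Nat.mul_le_mul (Nat.mul_le_mul h3' h2') (le_refl K)])
  have a2 := aux _ _ n3 (K * K) (by push_cast at h2'' ⊢; exact h2'') (by positivity)
    (by nlinarith)
  refine ⟨n3 * n2 * n1, by positivity, ?_, (n3 * n2 : ℕ) * round (n1 * x), n3 * round (n2 * (n1 * y)), round (n3 * (n2 * n1 * z)), ?_, ?_, ?_⟩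
  · exact Nat.mul_le_mul (Nat.mul_le_mul h3' h2') h1'
  · convert a1 using 2; push_cast; ring
  · convert a2 using 2; push_cast; ring
  · have : ((n3 * n2 * n1 : ℕ):ℝ) * z = n3 * (n2 * n1 * z) := by push_cast; ring
    rw [this]
    refine h3''.trans ?_
    apply one_div_le_one_div_of_le hKR; linarith

def HH (x y z t : ℝ) (m : ℕ) : Prop :=
  ⌊m * x⌋ + ⌊m * y⌋ + ⌊m * z⌋ + ⌊m * t⌋ = ⌊m * (x + y)⌋ + m - 2

theorem recur_s10 : ∃ N : ℕ, 1000 ≤ N ∧ ∀ x y z t ε : ℝ, 1/7 ≤ x → 1/7 ≤ y → 0 ≤ z → 0 ≤ t → 0 < ε →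
    ε * N < 1 → x + y ≤ 5/6 → z + t = 1 - ε →
    (∀ m : ℕ, 2 ≤ m → m + 1 ≤ N → HH x y z t m) → False := by
  obtain ⟨M, hM⟩ := Dir 24 (by norm_num)
  obtain ⟨M', hM'⟩ := Dir (24 * (M + 1)) (by positivity)
  refine ⟨1000 * (M + 1) * (M' + 1), by nlinarith, ?_⟩
  intro x y z t ε hx hy hz ht hε hεN hxy hzt hH
  push_cast at hεN
  have hM0 : (0:ℝ) ≤ M := by positivity
  have hM0' : (0:ℝ) ≤ M' := by positivity
  have hKpos : (0:ℝ) < M + 1 := by linarith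
  have hKpos' : (0:ℝ) < M' + 1 := by linarith
  set η : ℝ := 1 / (M + 1) with hη
  have hη0 : 0 < η := by positivity
  have hηM : η * (M + 1) = 1 := by rw [hη]; field_simp
  have hη1 : η ≤ 1 := by nlinarith
  -- ε * (M'+1) ≤ η / 1000
  have he' : ε * (M' + 1) ≤ η / 1000 := by
    have : ε * (M'+1) * (M+1) ≤ η / 1000 * (M+1) := by nlinarith
    exact le_of_mul_le_mul_right this hKpos
  have he : ε * (M + 1) ≤ 1 / 1000 := by nlinarith [mul_pos hε hKpos]
  have key : ∀ n : ℕ, 0 < n → (n ≤ M ∨ n ≤ M') → ∀ p q : ℤ, |n * x - p| ≤ 1/24 → |n * y - q| ≤ 1/24 →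
      ⌊((n+1 : ℕ):ℝ) * z⌋ + ⌊((n+1 : ℕ):ℝ) * t⌋ = n - 1 := by
    intro n hn hnM p q hp hq
    have h := hH (n+1) (by omega) (by
      have i1 : (M + 1) * 1 ≤ (M + 1) * (M' + 1) := Nat.mul_le_mul_left _ (by omega)
      have i2 : 1 * (M' + 1) ≤ (M + 1) * (M' + 1) := Nat.mul_le_mul_right _ (by omega)
      rw [mul_assoc]
      generalize (M + 1) * (M' + 1) = W at *
      omega)
    unfold HH at h
    rw [abs_le] at hp hq
    have f1 : ⌊((n+1 : ℕ):ℝ) * x⌋ = p := by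
      rw [Int.floor_eq_iff]; push_cast; constructor <;> nlinarith
    have f2 : ⌊((n+1 : ℕ):ℝ) * y⌋ = q := by
      rw [Int.floor_eq_iff]; push_cast; constructor <;> nlinarith
    have f3 : ⌊((n+1 : ℕ):ℝ) * (x + y)⌋ = p + q := by
      rw [Int.floor_eq_iff]; push_cast; constructor <;> nlinarith
    rw [f1, f2, f3] at h
    push_cast at h ⊢
    linarith
  obtain ⟨n, hn, hnM, p, q, l, hp, hq, -⟩ := hM x y 0
  have hk := key n hn (Or.inl hnM) p q (by simpa using hp) (by simpa using hq)
  have hnR : (n:ℝ) ≤ M := by exact_mod_cast hnM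
  have hn1 : (1:ℝ) ≤ n := by exact_mod_cast hn
  have small : ∀ z t : ℝ, 0 ≤ z → z + t = 1 - ε → z ≤ η / 2 →
      (n:ℤ) ≤ ⌊((n+1 : ℕ):ℝ) * z⌋ + ⌊((n+1 : ℕ):ℝ) * t⌋ := by
    intro z t hz hzt hzs
    have g1 : (0:ℤ) ≤ ⌊((n+1 : ℕ):ℝ) * z⌋ := by positivity
    have g2 : (n:ℤ) ≤ ⌊((n+1 : ℕ):ℝ) * t⌋ := by
      rw [Int.le_floor]; push_cast
      have : t = 1 - ε - z := by linarith
      rw [this]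
      have b1 : (n + 1 : ℝ) * z ≤ (M + 1) * (η/2) := by gcongr
      have b2 : (n + 1 : ℝ) * ε ≤ (M + 1) * ε := by gcongr
      nlinarith
    linarith
  rcases le_or_gt z (η/2) with hz2 | hz2
  · have := small z t hz hzt hz2; omega
  rcases le_or_gt t (η/2) with ht2 | ht2
  · have := small t z ht (by linarith) ht2; omega
  clear hk small hp hq hnR hn1
  obtain ⟨n, hn, hnM, p, q, l, hp, hq, hl⟩ := hM' x y z
  have hnR : (n:ℝ) ≤ M' := by exact_mod_cast hnM
  have hKK : 1 / ((24 * (M+1) : ℕ):ℝ) = η / 24 := by rw [hη]; push_cast; field_simp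
  rw [hKK] at hp hq hl
  have hk := key n hn (Or.inr hnM) p q (by linarith) (by linarith)
  rw [abs_le] at hl
  have g1 : l ≤ ⌊((n+1 : ℕ):ℝ) * z⌋ := by
    rw [Int.le_floor]; push_cast; nlinarith
  have g2 : (n:ℤ) - l ≤ ⌊((n+1 : ℕ):ℝ) * t⌋ := by
    rw [Int.le_floor]; push_cast
    have : z = 1 - ε - t := by linarith
    rw [this] at hl
    have b2 : (n + 1 : ℝ) * ε ≤ (M' + 1) * ε := by gcongr
    nlinarith
  omega

set_option maxHeartbeats 2000000 in
theorem core_s10 : ∃ N : ℕ, 13 ≤ N ∧ ∀ (x y z t ε : ℝ) (s q : ℕ), 0 < x → 0 < y → 0 ≤ z → 0 ≤ t → 0 < ε →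
    ε * N < 1 → x + y < 1 → z + t = 1 - ε → s * z + q * t = x + y → 2 ≤ s + q → 
    (∀ m : ℕ, 2 ≤ m → m + 1 ≤ N → HH x y z t m) → False := by
  obtain ⟨N, hN, hrec⟩ := recur_s10
  refine ⟨N, by omega, ?_⟩
  have main : ∀ (x y z t ε : ℝ) (s q : ℕ), 0 < x → 0 < y → 0 ≤ z → 0 ≤ t → 0 < ε →
    ε * N < 1 → x + y < 1 → z + t = 1 - ε → s * z + q * t = x + y → 2 ≤ s + q → z ≤ t →
    (∀ m : ℕ, 2 ≤ m → m + 1 ≤ N → HH x y z t m) → False := by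
    intro x y z t ε s q hx hy hz ht hε hεN hxy hzt hsq hsq2 hle hH
    have hεs : ε < 1/1000 := by
      have : (1000:ℝ) ≤ N := by exact_mod_cast hN
      nlinarith
    have H2 := hH 2 (by norm_num) (by omega)
    have H3 := hH 3 (by norm_num) (by omega)
    have H5 := hH 5 (by norm_num) (by omega)
    unfold HH at H2 H3 H5
    push_cast at H2 H3 H5
    have hsR : (2:ℝ) ≤ s + q := by exact_mod_cast hsq2
    have hs0 : (0:ℝ) ≤ s := by positivity
    have hq0 : (0:ℝ) ≤ q := by positivity
    have fl : ∀ (w : ℝ) (i : ℤ), (i:ℝ) ≤ w → w < i + 1 → ⌊w⌋ = i := fun w i h1 h2 =>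
      Int.floor_eq_iff.2 ⟨h1, h2⟩
    by_cases h2c : t < 1/2
    · -- carry at 2
      have hu : 1 - 2 * ε ≤ x + y := by
        rw [← hsq]
        have : (1/2 - ε) * (s + q) ≤ s * z + q * t := by nlinarith
        nlinarith
      rw [fl (3*z) 1 (by push_cast; linarith) (by push_cast; linarith),
        fl (3*t) 1 (by push_cast; linarith) (by push_cast; linarith),
        fl (3*(x+y)) 2 (by push_cast; linarith) (by push_cast; linarith)] at H3
      rw [fl (5*z) 2 (by push_cast; linarith) (by push_cast; linarith),
        fl (5*t) 2 (by push_cast; linarith) (by push_cast; linarith),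
        fl (5*(x+y)) 4 (by push_cast; linarith) (by push_cast; linarith)] at H5
      have s1 : x < 2/3 := by
        by_contra h
        have : (2:ℤ) ≤ ⌊3*x⌋ := by rw [Int.le_floor]; push_cast; linarith
        have : (0:ℤ) ≤ ⌊3*y⌋ := by positivity
        omega
      have s2 : y < 2/3 := by
        by_contra h
        have : (2:ℤ) ≤ ⌊3*y⌋ := by rw [Int.le_floor]; push_cast; linarith
        have : (0:ℤ) ≤ ⌊3*x⌋ := by positivity
        omega
      have s3 : x < 1/3 ∨ y < 1/3 := by
        by_contra! h
        have : (1:ℤ) ≤ ⌊3*y⌋ := by rw [Int.le_floor]; push_cast; linarith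
        have : (1:ℤ) ≤ ⌊3*x⌋ := by rw [Int.le_floor]; push_cast; linarith
        omega
      rcases s3 with s3 | s3
      · rw [fl (5*x) 1 (by push_cast; linarith) (by push_cast; linarith),
          fl (5*y) 3 (by push_cast; linarith) (by push_cast; linarith)] at H5
        omega
      · rw [fl (5*x) 3 (by push_cast; linarith) (by push_cast; linarith),
          fl (5*y) 1 (by push_cast; linarith) (by push_cast; linarith)] at H5
        omega
    · push Not at h2c
      rw [fl (2*z) 0 (by push_cast; linarith) (by push_cast; linarith),
        fl (2*t) 1 (by push_cast; linarith) (by push_cast; linarith)] at H2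
      have x0 : (0:ℤ) ≤ ⌊2*x⌋ := by positivity
      have y0 : (0:ℤ) ≤ ⌊2*y⌋ := by positivity
      have s0 : ⌊2*(x+y)⌋ < 2 := by rw [Int.floor_lt]; push_cast; linarith
      have s0' : 1/2 ≤ x + y := by
        have : (1:ℤ) ≤ ⌊2*(x+y)⌋ := by omega
        rw [Int.le_floor] at this; push_cast at this; linarith
      have x1 : x < 1/2 := by
        have : ⌊2*x⌋ < 1 := by omega
        rw [Int.floor_lt] at this; push_cast at this; linarith
      have y1 : y < 1/2 := by
        have : ⌊2*y⌋ < 1 := by omega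
        rw [Int.floor_lt] at this; push_cast at this; linarith
      by_cases hc3 : 1/3 - ε < z ∧ z < 1/3
      · obtain ⟨c1, c2⟩ := hc3
        by_cases hu : x + y ≤ 5/6
        · have : (1/3 - ε) * (s + q) ≤ s * z + q * t := by nlinarith
          have hu' : 2/3 - 2*ε ≤ x + y := by nlinarith
          exact hrec x y z t ε (by linarith) (by linarith) hz ht hε hεN hu hzt hH
        · push Not at hu
          have h3 : 3 ≤ s + 2 * q := by
            by_contra h
            have : ((s + 2 * q : ℕ):ℝ) ≤ 2 := by exact_mod_cast (by omega : s + 2 * q ≤ 2)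
            push_cast at this
            nlinarith
          have h3R : (3:ℝ) ≤ s + 2 * q := by exact_mod_cast h3
          have : (1/3 - ε) * (s + 2 * q) ≤ s * z + q * t := by nlinarith
          have hu' : 1 - 3*ε ≤ x + y := by nlinarith
          rw [fl (5*z) 1 (by push_cast; linarith) (by push_cast; linarith),
            fl (5*t) 3 (by push_cast; linarith) (by push_cast; linarith),
            fl (5*(x+y)) 4 (by push_cast; linarith) (by push_cast; linarith),
            fl (5*x) 2 (by push_cast; linarith) (by push_cast; linarith),
            fl (5*y) 2 (by push_cast; linarith) (by push_cast; linarith)] at H5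
          omega
      · -- no carry at 3
        have hzt3 : ⌊3*z⌋ + ⌊3*t⌋ = 2 := by
          rcases lt_or_ge z (1/3) with h | h
          · have : z ≤ 1/3 - ε := by
              by_contra h'
              exact hc3 ⟨by linarith, h⟩
            rw [fl (3*z) 0 (by push_cast; linarith) (by push_cast; linarith),
              fl (3*t) 2 (by push_cast; linarith) (by push_cast; linarith)]
            norm_num
          · rw [fl (3*z) 1 (by push_cast; linarith) (by push_cast; linarith),
              fl (3*t) 1 (by push_cast; linarith) (by push_cast; linarith)]
            norm_num
        have H3' : ⌊3*x⌋ + ⌊3*y⌋ + 1 = ⌊3*(x+y)⌋ := by omega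
        have fin : x + y ≤ 5/6 ∧ 1/7 ≤ x ∧ 1/7 ≤ y := by
          rcases lt_or_ge x (1/3) with hx3 | hx3 <;> rcases lt_or_ge y (1/3) with hy3 | hy3
          · refine ⟨?_, ?_, ?_⟩ <;> linarith
          · rw [fl (3*x) 0 (by push_cast; linarith) (by push_cast; linarith),
              fl (3*y) 1 (by push_cast; linarith) (by push_cast; linarith)] at H3'
            have : (2:ℤ) ≤ ⌊3*(x+y)⌋ := by omega
            rw [Int.le_floor] at this; push_cast at this
            refine ⟨?_, ?_, ?_⟩ <;> linarith
          · rw [fl (3*x) 1 (by push_cast; linarith) (by push_cast; linarith),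
              fl (3*y) 0 (by push_cast; linarith) (by push_cast; linarith)] at H3'
            have : (2:ℤ) ≤ ⌊3*(x+y)⌋ := by omega
            rw [Int.le_floor] at this; push_cast at this
            refine ⟨?_, ?_, ?_⟩ <;> linarith
          · rw [fl (3*x) 1 (by push_cast; linarith) (by push_cast; linarith),
              fl (3*y) 1 (by push_cast; linarith) (by push_cast; linarith)] at H3'
            have : (3:ℤ) ≤ ⌊3*(x+y)⌋ := by omega
            rw [Int.le_floor] at this; push_cast at this
            refine ⟨?_, ?_, ?_⟩ <;> linarith
        exact hrec x y z t ε fin.2.1 fin.2.2 hz ht hε hεN fin.1 hzt hH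
  intro x y z t ε s q hx hy hz ht hε hεN hxy hzt hsq hsq2 hH
  rcases le_total z t with h | h
  · exact main x y z t ε s q hx hy hz ht hε hεN hxy hzt hsq hsq2 h hH
  · refine main x y t z ε q s hx hy ht hz hε hεN hxy (by linarith) (by linarith) (by omega) h ?_
    intro m h1 h2
    have := hH m h1 h2
    unfold HH at this ⊢
    linarith

def wt (p : Fin 4 → ℤ) (m : Fin 4 → ℕ) : ℤ :=
  (m 0 : ℤ) * p 0 + (m 1 : ℤ) * p 1 + (m 2 : ℤ) * p 2 + (m 3 : ℤ) * p 3

def vec (r : ℤ) (p : Fin 4 → ℤ) : Fin 4 → ℚ := fun i => ((p i : ℤ) : ℚ) / (r : ℚ)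

theorem wt_nonneg (p : Fin 4 → ℤ) (hp : ∀ i, 0 ≤ p i) (m : Fin 4 → ℕ) : 0 ≤ wt p m := by
  unfold wt
  have := hp 0; have := hp 1; have := hp 2; have := hp 3
  positivity

theorem vf_spec (r : ℤ) (hr : 0 < r) (S : Set (Fin 4 → ℕ)) (hS : S.Nonempty) (p : Fin 4 → ℤ)
    (hp : ∀ i, 0 ≤ p i) :
    ∃ m₀ ∈ S, (∀ m ∈ S, wt p m₀ ≤ wt p m) ∧ vf S (vec r p) = (wt p m₀ : ℝ) / r := by
  have hrR : (0:ℝ) < r := by exact_mod_cast hr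
  let f : (Fin 4 → ℕ) → ℕ := fun m => (wt p m).toNat
  have hmin : ∀ m ∈ S, wt p (Function.argminOn f S hS) ≤ wt p m := by
    intro m hm
    have h1 := Function.not_lt_argminOn f S hm
    have h2 := wt_nonneg p hp m
    simp only [f] at h1 ⊢
    omega
  refine ⟨Function.argminOn f S hS, Function.argminOn_mem f S hS, hmin, ?_⟩
  have e : ∀ m : Fin 4 → ℕ, ∑ i : Fin 4, (m i : ℝ) * ((vec r p i : ℚ) : ℝ) = (wt p m : ℝ) / r := by
    intro m
    simp only [Fin.sum_univ_four, vec, wt]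
    push_cast
    field_simp
  unfold vf
  apply IsLeast.csInf_eq
  constructor
  · exact ⟨_, Function.argminOn_mem f S hS, (e _).symm⟩
  · rintro x ⟨m, hm, rfl⟩
    rw [e m]
    have : (wt p (Function.argminOn f S hS) : ℝ) ≤ wt p m := by exact_mod_cast hmin m hm
    gcongr

theorem vec_mem (r a b c d k : ℤ) (hr : 0 < r) (p : Fin 4 → ℤ) (hp : ∀ i, 0 ≤ p i)
    (hk : ∀ i, r ∣ p i - k * ![a, b, c, d] i) : vec r p ∈ latN r a b c d ∩ orth := by
  have hrR : (0:ℚ) < r := by exact_mod_cast hr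
  choose n hn using hk
  refine ⟨⟨k, n, fun i => ?_⟩, fun i => ?_⟩
  · have : p i = k * ![a, b, c, d] i + r * n i := by linarith [hn i]
    unfold vec
    rw [this]
    push_cast
    field_simp
  · have : (0:ℚ) ≤ p i := by exact_mod_cast hp i
    unfold vec
    positivity

theorem w_vec (r : ℤ) (p : Fin 4 → ℤ) :
    ((w (vec r p) : ℚ) : ℝ) = ((p 0 + p 1 + p 2 + p 3 : ℤ) : ℝ) / r := by
  simp only [w, Fin.sum_univ_four, vec]
  push_cast
  ring

theorem vec_inj (r : ℤ) (hr : 0 < r) (p q : Fin 4 → ℤ) (h : vec r p = vec r q) (i : Fin 4) :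
    p i = q i := by
  have hrR : (0:ℚ) < r := by exact_mod_cast hr
  have := congrFun h i
  unfold vec at this
  field_simp at this
  exact_mod_cast this

theorem vec_corner (r : ℤ) (hr : 0 < r) (p : Fin 4 → ℤ) (h1 : 0 < p 1) (h2 : p 1 < r) :
    vec r p ∉ corners := by
  have hrR : (0:ℚ) < r := by exact_mod_cast hr
  have h1' : (0:ℚ) < p 1 := by exact_mod_cast h1
  have h2' : (p 1:ℚ) < r := by exact_mod_cast h2
  have a1 : 0 < vec r p 1 := by unfold vec; positivity
  have a2 : vec r p 1 < 1 := by unfold vec; rw [div_lt_one hrR]; exact h2'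
  rintro (h | ⟨i, h⟩)
  · rw [h] at a1; simp at a1
  · have := congrFun h 1
    split_ifs at this <;> linarith

theorem rule_out (r a b c d k : ℤ) (δ : ℝ) (S : Set (Fin 4 → ℕ)) (B : Set (Fin 4 → ℚ))
    (hr : 0 < r) (hS : S.Nonempty) (hI : RuleI r a b c d δ S B) (p : Fin 4 → ℤ) (hp : ∀ i, 0 ≤ p i)
    (hk : ∀ i, r ∣ p i - k * ![a, b, c, d] i) (h1 : 0 < p 1) (h2 : p 1 < r) (hB : vec r p ∉ B) :
    ∃ m₀ ∈ S, (∀ m ∈ S, wt p m₀ ≤ wt p m) ∧ wt p m₀ + r < p 0 + p 1 + p 2 + p 3 := by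
  have hrR : (0:ℝ) < r := by exact_mod_cast hr
  obtain ⟨m₀, hm, hmin, hv⟩ := vf_spec r hr S hS p hp
  refine ⟨m₀, hm, hmin, ?_⟩
  have := hI.2.2.2 _ (vec_mem r a b c d k hr p hp hk) hB (vec_corner r hr p h1 h2)
  rw [hv, w_vec, ← sub_div, lt_div_iff₀ hrR] at this
  have h : (1:ℤ) * r < p 0 + p 1 + p 2 + p 3 - wt p m₀ := by exact_mod_cast this
  linarith

theorem rule_in (r a b c d : ℤ) (δ : ℝ) (S : Set (Fin 4 → ℕ)) (B : Set (Fin 4 → ℚ))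
    (hr : 0 < r) (hS : S.Nonempty) (hI : RuleI r a b c d δ S B) (p : Fin 4 → ℤ) (hp : ∀ i, 0 ≤ p i)
    (hB : vec r p ∈ B) :
    ∃ m₀ ∈ S, (∀ m ∈ S, wt p m₀ ≤ wt p m) ∧ p 0 + p 1 + p 2 + p 3 - wt p m₀ < r ∧
      (1 - δ) * r < ((p 0 + p 1 + p 2 + p 3 - wt p m₀ : ℤ) : ℝ) := by
  have hrR : (0:ℝ) < r := by exact_mod_cast hr
  obtain ⟨m₀, hm, hmin, hv⟩ := vf_spec r hr S hS p hp
  refine ⟨m₀, hm, hmin, ?_⟩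
  obtain ⟨-, h1, h2⟩ := hI.2.2.1 _ hB
  rw [hv, w_vec, ← sub_div] at h1 h2
  rw [lt_div_iff₀ hrR] at h1
  rw [div_lt_iff₀ hrR] at h2
  constructor
  · have h : p 0 + p 1 + p 2 + p 3 - wt p m₀ < 1 * r := by exact_mod_cast h2
    linarith
  · push_cast at h1 ⊢
    linarith

theorem emod_uniq (r n x : ℤ) (h0 : 0 ≤ x) (h1 : x < r) (h : r ∣ n - x) : n % r = x := by
  have : n % r = x % r := (Int.modEq_iff_dvd.2 h : x ≡ n [ZMOD r]).symm
  rw [this, Int.emod_eq_of_lt h0 h1]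

theorem two_vals (r n : ℤ) (h : r ∣ n) (h0 : -r < n) (h1 : n < 2 * r) : n = 0 ∨ n = r := by
  obtain ⟨q, rfl⟩ := h
  have hr : 0 < r := by linarith
  have a1 : -1 < q := by nlinarith
  have a2 : q < 2 := by nlinarith
  have : q = 0 ∨ q = 1 := by omega
  rcases this with rfl | rfl <;> simp

theorem dvd_emod (r n : ℤ) : r ∣ n - n % r := Int.dvd_self_sub_emod

theorem compl (r u k : ℤ) (hr : 0 < r) :
    (u * k % r = 0 ∧ u * (r - k) % r = 0) ∨ (0 < u * k % r ∧ u * (r - k) % r = r - u * k % r) := by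
  have h0 := Int.emod_nonneg (u * k) hr.ne'
  have h1 := Int.emod_lt_of_pos (u * k) hr
  have hd := dvd_emod r (u * k)
  rcases h0.eq_or_lt with h | h
  · left
    refine ⟨h.symm, emod_uniq _ _ _ le_rfl hr ?_⟩
    rw [← h] at hd
    have : u * (r - k) - 0 = r * u - (u * k - 0) := by ring
    rw [this]; exact dvd_sub (dvd_mul_right _ _) hd
  · right
    refine ⟨h, emod_uniq _ _ _ (by linarith) (by linarith) ?_⟩
    have : u * (r - k) - (r - u * k % r) = r * u - r - (u * k - u * k % r) := by ring
    rw [this]; exact dvd_sub (dvd_sub (dvd_mul_right _ _) (dvd_refl r)) hd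

theorem cop (r u v e : ℤ) (hg : Int.gcd u r ∣ Int.gcd e r) (huv : Int.gcd u (Int.gcd v r) = 1)
    (he : r ∣ e - (u + v)) : IsCoprime u r := by
  rw [Int.isCoprime_iff_gcd_eq_one]
  have h1 : (Int.gcd u r : ℤ) ∣ u := Int.gcd_dvd_left ..
  have h2 : (Int.gcd u r : ℤ) ∣ r := Int.gcd_dvd_right ..
  have h3 : (Int.gcd u r : ℤ) ∣ e := (Int.natCast_dvd_natCast.2 hg).trans (Int.gcd_dvd_left ..)
  have h4 : (Int.gcd u r : ℤ) ∣ v := by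
    have : v = e - u - (e - (u + v)) := by ring
    rw [this]; exact dvd_sub (dvd_sub h3 h1) (h2.trans he)
  have h5 : (Int.gcd u r : ℤ) ∣ Int.gcd u (Int.gcd v r) := Int.dvd_coe_gcd h1 (Int.dvd_coe_gcd h4 h2)
  rw [huv] at h5
  have := Int.natCast_dvd_natCast.1 h5
  exact Nat.dvd_one.1 this

theorem cop_pos (r u k : ℤ) (h : IsCoprime u r) (hk : 1 ≤ k) (hk' : k ≤ r - 1) : 0 < u * k % r := by
  have hr : 0 < r := by linarith
  rcases (Int.emod_nonneg (u * k) hr.ne').eq_or_lt with h0 | h0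
  · have h1 : r ∣ u * k := Int.dvd_of_emod_eq_zero h0.symm
    have h2 : r ∣ k := h.symm.dvd_of_dvd_mul_left h1
    have := Int.le_of_dvd (by linarith) h2
    linarith
  · exact h0

def pk (r a b c d k : ℤ) : Fin 4 → ℤ := ![a * k % r, b * k % r, c * k % r, d * k % r]

theorem floor_div' (n r : ℤ) (hr : 0 < r) : ⌊(n:ℝ) / r⌋ = n / r := by
  have hrR : (0:ℝ) < r := by exact_mod_cast hr
  rw [Int.floor_div_cast_of_nonneg hr.le, Int.floor_intCast]

set_option maxHeartbeats 4000000 in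
theorem main_arith (N : ℕ) (hN : 13 ≤ N)
    (hcore : ∀ (x y z t ε : ℝ) (s q : ℕ), 0 < x → 0 < y → 0 ≤ z → 0 ≤ t → 0 < ε →
      ε * N < 1 → x + y < 1 → z + t = 1 - ε → s * z + q * t = x + y → 2 ≤ s + q →
      (∀ m : ℕ, 2 ≤ m → m + 1 ≤ N → HH x y z t m) → False)
    (r : ℤ) (δ : ℝ) (a b c d e : ℤ) (S : Set (Fin 4 → ℕ)) (B : Set (Fin 4 → ℚ))
    (hr13 : 13 < r) (hδ : δ ≤ 1 / N)
    (hW : WeightCond r a b c d e S) (hI : RuleI r a b c d δ S B) (hII : RuleII r a b c d e)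
    (hF : FormCA S) (k : ℤ) (hk1 : 1 ≤ k) (hk2 : k ≤ r - 1) :
    a * k % r + b * k % r + c * k % r + d * k % r = e * k % r + k + r := by
  have hr : 0 < r := by linarith
  have hS : S.Nonempty := ⟨_, hF.1⟩
  obtain ⟨g1, g2, -, -, gab, -, -, -, -, -, hsum⟩ := hII
  have hab : r ∣ e - (a + b) := by
    have := hW _ hF.1
    simp at this
    exact this.dvd
  have hcd : r ∣ c + d - 1 := by
    have h1 := hsum.symm.dvd
    have : c + d - 1 = (a + b + c + d - e - 1) + (e - (a + b)) := by ring
    rw [this]; exact dvd_add h1 hab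
  have ca : IsCoprime a r := cop r a b e g1 gab hab
  have cb : IsCoprime b r := cop r b a e g2
    (by rw [← gab]; rw [← Int.gcd_assoc, ← Int.gcd_assoc, Int.gcd_comm b a]) (by rwa [add_comm])
  have ap : ∀ k, 1 ≤ k → k ≤ r - 1 → 0 < a * k % r := fun k => cop_pos r a k ca
  have bp : ∀ k, 1 ≤ k → k ≤ r - 1 → 0 < b * k % r := fun k => cop_pos r b k cb
  have nn : ∀ u k : ℤ, 0 ≤ u * k % r := fun u k => Int.emod_nonneg _ hr.ne'
  have lt : ∀ u k : ℤ, u * k % r < r := fun u k => Int.emod_lt_of_pos _ hr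
  have pkn : ∀ k i, 0 ≤ pk r a b c d k i := by
    intro k i; fin_cases i <;> simp [pk, nn]
  have hAB : ∀ k, a * k % r + b * k % r = e * k % r ∨ a * k % r + b * k % r = e * k % r + r := by
    intro k
    have : r ∣ a * k % r + b * k % r - e * k % r := by
      have : a * k % r + b * k % r - e * k % r = (e * k - e * k % r) - (a * k - a * k % r)
        - (b * k - b * k % r) - (e - (a + b)) * k := by ring
      rw [this]
      exact dvd_sub (dvd_sub (dvd_sub (dvd_emod _ _) (dvd_emod _ _)) (dvd_emod _ _))
        (Dvd.dvd.mul_right hab k)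
    have h1 := nn a k; have h2 := nn b k; have h3 := nn e k
    have h4 := lt a k; have h5 := lt b k; have h6 := lt e k
    rcases two_vals r _ this (by linarith) (by linarith) with h | h
    · left; linarith
    · right; linarith
  have hCD : ∀ k, 1 ≤ k → k ≤ r - 1 → c * k % r + d * k % r = k ∨ c * k % r + d * k % r = k + r := by
    intro k hk1 hk2
    have : r ∣ c * k % r + d * k % r - k := by
      have : c * k % r + d * k % r - k = (c + d - 1) * k - (c * k - c * k % r)
        - (d * k - d * k % r) := by ring
      rw [this]
      exact dvd_sub (dvd_sub (Dvd.dvd.mul_right hcd k) (dvd_emod _ _)) (dvd_emod _ _)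
    have h1 := nn c k; have h2 := nn d k
    have h4 := lt c k; have h5 := lt d k
    rcases two_vals r _ this (by linarith) (by linarith) with h | h
    · left; linarith
    · right; linarith
  -- congruence for weights
  have hwt : ∀ k p, (∀ i, r ∣ p i - k * ![a, b, c, d] i) → ∀ m ∈ S, r ∣ wt p m - e * k % r := by
    intro k p hp m hm
    have h0 := hp 0; have h1 := hp 1; have h2 := hp 2; have h3 := hp 3
    simp at h0 h1 h2 h3
    have h4 := (hW m hm).dvd
    have : wt p m - e * k % r = (m 0 : ℤ) * (p 0 - k * a) + (m 1 : ℤ) * (p 1 - k * b) +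
      (m 2 : ℤ) * (p 2 - k * c) + (m 3 : ℤ) * (p 3 - k * d) -
      k * (e - ((m 0 : ℤ) * a + (m 1 : ℤ) * b + (m 2 : ℤ) * c + (m 3 : ℤ) * d)) +
      (e * k - e * k % r) := by unfold wt; ring
    rw [this]
    exact dvd_add (dvd_sub (dvd_add (dvd_add (dvd_add (h0.mul_left _) (h1.mul_left _))
      (h2.mul_left _)) (h3.mul_left _)) (h4.mul_left _)) (dvd_emod _ _)
  have pkd : ∀ k i, r ∣ pk r a b c d k i - k * ![a, b, c, d] i := by
    intro k i
    have : ∀ u : ℤ, r ∣ u * k % r - k * u := by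
      intro u
      have := dvd_emod r (u * k)
      rw [← dvd_neg]
      have e1 : -(u * k % r - k * u) = u * k - u * k % r := by ring
      rw [e1]; exact this
    fin_cases i <;> simpa [pk] using this _
  have hwE : ∀ k, ∀ m ∈ S, e * k % r ≤ wt (pk r a b c d k) m := by
    intro k m hm
    have h1 := hwt k _ (pkd k) m hm
    have h2 := wt_nonneg _ (pkn k) m
    have h3 := emod_uniq r _ _ (nn e k) (lt e k) h1
    rw [← h3]
    have h4 := Int.emod_add_mul_ediv (wt (pk r a b c d k) m) r
    have h5 := mul_nonneg hr.le (Int.ediv_nonneg h2 hr.le)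
    linarith
  have hP : ∀ k, 1 ≤ k → k ≤ r - 1 → vec r (pk r a b c d k) ∉ B → ∀ L : ℤ,
      (∀ m ∈ S, L ≤ wt (pk r a b c d k) m) →
      L + r < a * k % r + b * k % r + c * k % r + d * k % r := by
    intro k hk1 hk2 hB L hL
    obtain ⟨m₀, hm, -, h⟩ := rule_out r a b c d k δ S B hr hS hI _ (pkn k) (pkd k)
      (by simpa [pk] using bp k hk1 hk2) (by simpa [pk] using lt b k) hB
    have := hL m₀ hm
    simp [pk] at h this
    linarith
  have hgood : ∀ k, 1 ≤ k → k ≤ r - 1 → vec r (pk r a b c d k) ∉ B →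
      vec r (pk r a b c d (r - k)) ∉ B →
      a * k % r + b * k % r + c * k % r + d * k % r = e * k % r + k + r := by
    intro k hk1 hk2 hB hB'
    have h1 := hP k hk1 hk2 hB _ (hwE k)
    rcases hAB k with hab' | hab' <;> rcases hCD k hk1 hk2 with hcd' | hcd'
    · linarith
    · linarith
    · linarith
    · exfalso
      have hc := lt c k; have hd := lt d k
      have ha1 := ap k hk1 hk2; have hb1 := bp k hk1 hk2
      have ha2 := lt a k; have hb2 := lt b k
      rcases compl r a k hr with ⟨ha, ha'⟩ | ⟨ha, ha'⟩
      · linarith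
      rcases compl r b k hr with ⟨hb, hb'⟩ | ⟨hb, hb'⟩
      · linarith
      rcases compl r c k hr with ⟨hc0, hc'⟩ | ⟨hc0, hc'⟩
      · linarith
      rcases compl r d k hr with ⟨hd0, hd'⟩ | ⟨hd0, hd'⟩
      · linarith
      rcases compl r e k hr with ⟨he0, he'⟩ | ⟨he0, he'⟩
      · have := hP (r - k) (by linarith) (by linarith) hB' r (by
          intro m hm
          have h1 := hwt (r - k) _ (pkd (r - k)) m hm
          rw [he', sub_zero] at h1
          apply Int.le_of_dvd _ h1
          by_cases hm' : m = ![1, 1, 0, 0]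
          · rw [hm']; simp [wt, pk, ha', hb']; linarith
          · obtain ⟨e0, e1, e2⟩ := hF.2 m hm hm'
            simp only [wt, pk, e0, e1]
            simp [hc', hd']
            have e2' : (2:ℤ) ≤ (m 2 : ℤ) + m 3 := by exact_mod_cast e2
            have q1 : 1 ≤ r - c * k % r := by linarith
            have q2 : 1 ≤ r - d * k % r := by linarith
            nlinarith)
        linarith
      · have := hP (r - k) (by linarith) (by linarith) hB' _ (hwE _)
        linarith
  by_contra hbad
  have hk0 : ∃ k₀, 1 ≤ k₀ ∧ k₀ ≤ r - 1 ∧ vec r (pk r a b c d k₀) ∈ B ∧ (k = k₀ ∨ k = r - k₀) := by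
    by_cases h1 : vec r (pk r a b c d k) ∈ B
    · exact ⟨k, hk1, hk2, h1, Or.inl rfl⟩
    · by_cases h2 : vec r (pk r a b c d (r - k)) ∈ B
      · exact ⟨r - k, by linarith, by linarith, h2, Or.inr (by ring)⟩
      · exact absurd (hgood k hk1 hk2 h1 h2) hbad
  obtain ⟨k₀, h01, h02, h0B, h0k⟩ := hk0
  obtain ⟨m₀, hm₀, hmin, hV1, hV2⟩ := rule_in r a b c d δ S B hr hS hI _ (pkn k₀) h0B
  have hNR : (13:ℝ) ≤ N := by exact_mod_cast hN
  have hrR : (0:ℝ) < r := by exact_mod_cast hr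
  have hVd := hwt k₀ _ (pkd k₀) m₀ hm₀
  have hVab := hmin _ hF.1
  have hδN : δ * N ≤ 1 := by
    rw [le_div_iff₀ (by linarith)] at hδ; exact hδ
  have hδ13 : δ < 1 := by nlinarith
  obtain ⟨V, hVdef⟩ : ∃ V, V = wt (pk r a b c d k₀) m₀ := ⟨_, rfl⟩
  rw [← hVdef] at hV1 hV2 hVd hVab
  simp [pk, wt] at hV1 hV2 hVab
  have hVeq : a * k₀ % r + b * k₀ % r + c * k₀ % r + d * k₀ % r - V = k₀ := by
    have hd1 : r ∣ a * k₀ % r + b * k₀ % r + c * k₀ % r + d * k₀ % r - V - k₀ := by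
      have q1 : r ∣ a * k₀ % r + b * k₀ % r - e * k₀ % r := by
        rcases hAB k₀ with h | h <;> rw [h] <;> simp
      have q2 : r ∣ c * k₀ % r + d * k₀ % r - k₀ := by
        rcases hCD k₀ h01 h02 with h | h <;> rw [h] <;> simp
      have : a * k₀ % r + b * k₀ % r + c * k₀ % r + d * k₀ % r - V - k₀ =
        (a * k₀ % r + b * k₀ % r - e * k₀ % r) + (c * k₀ % r + d * k₀ % r - k₀)
          - (V - e * k₀ % r) := by ring
      rw [this]; exact dvd_sub (dvd_add q1 q2) hVd
    have hpos : 0 < a * k₀ % r + b * k₀ % r + c * k₀ % r + d * k₀ % r - V := by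
      have : (0:ℝ) < (1 - δ) * r := by apply mul_pos _ hrR; linarith
      have := this.trans hV2
      exact_mod_cast this
    rcases two_vals r _ hd1 (by linarith) (by linarith) with h | h <;> linarith
  have hV2' : (1 - δ) * r < (k₀:ℝ) := by
    rw [← hVeq]; push_cast; exact hV2
  have hcd0 : c * k₀ % r + d * k₀ % r = k₀ := by
    rcases hCD k₀ h01 h02 with h | h <;> linarith
  obtain ⟨j, hj⟩ : ∃ j, j = r - k₀ := ⟨_, rfl⟩
  have hjN : j * N < r := by
    have : (j:ℝ) * N < r := by
      rw [hj]; push_cast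
      nlinarith
    exact_mod_cast this
  have hj1 : 1 ≤ j := by linarith
  have hNZ : (13:ℤ) ≤ N := by exact_mod_cast hN
  have hj13 : 13 * j < r := by nlinarith
  have hother : ∀ k', 1 ≤ k' → k' ≤ r - 1 → k' ≠ k₀ → vec r (pk r a b c d k') ∉ B := by
    intro k' h1 h2 hne hB
    apply hne
    have h3 := vec_inj r hr _ _ (hI.1 hB h0B) 0
    simp [pk] at h3
    have h4 : r ∣ a * (k' - k₀) := by
      have h5 := dvd_sub (dvd_emod r (a * k')) (dvd_emod r (a * k₀))
      rw [h3] at h5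
      have e1 : a * k' - a * k₀ % r - (a * k₀ - a * k₀ % r) = a * (k' - k₀) := by ring
      rw [e1] at h5; exact h5
    have h6 : r ∣ k' - k₀ := ca.symm.dvd_of_dvd_mul_left h4
    rcases two_vals r _ h6 (by linarith) (by linarith) with h | h <;> linarith
  have hconc : ∀ k', 1 ≤ k' → k' ≤ r - 1 → k' ≠ k₀ → k' ≠ j →
      a * k' % r + b * k' % r + c * k' % r + d * k' % r = e * k' % r + k' + r := by
    intro k' h1 h2 h3 h4
    exact hgood k' h1 h2 (hother k' h1 h2 h3)
      (hother _ (by linarith) (by linarith) (by intro h; apply h4; linarith))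
  have cases : a * k₀ % r + b * k₀ % r = e * k₀ % r ∨
      (e * k₀ % r = 0 ∧ 0 < c * k₀ % r ∧ 0 < d * k₀ % r) := by
    rcases hAB k₀ with h | h
    · exact Or.inl h
    · right
      have hkj : k = j := by
        rcases h0k with h' | h'
        · exfalso; apply hbad; rw [h']; linarith
        · rw [h', hj]
      rw [hkj] at hbad
      have hjr : j ≤ r - 1 := by linarith
      have h1 := hP j hj1 hjr (hother j hj1 hjr (by intro h; linarith)) _ (hwE j)
      have h2 : a * j % r + b * j % r = e * j % r + r ∧ c * j % r + d * j % r = j + r := by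
        rcases hAB j with h3 | h3 <;> rcases hCD j hj1 hjr with h4 | h4
        · linarith
        · exfalso; apply hbad; linarith
        · exfalso; apply hbad; linarith
        · exact ⟨h3, h4⟩
      have ca := compl r a k₀ hr
      have cb := compl r b k₀ hr
      have cc := compl r c k₀ hr
      have cd := compl r d k₀ hr
      have ce := compl r e k₀ hr
      rw [← hj] at ca cb cc cd ce
      have := ap k₀ h01 h02; have := bp k₀ h01 h02
      have := lt c k₀; have := lt d k₀; have := lt e k₀
      have := lt c j; have := lt d j; have := lt e j
      have := nn c j; have := nn d j; have := nn e j; have := nn e k₀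
      generalize a * k₀ % r = A0 at *
      generalize b * k₀ % r = B0 at *
      generalize c * k₀ % r = C0 at *
      generalize d * k₀ % r = D0 at *
      generalize e * k₀ % r = E0 at *
      generalize a * j % r = A1 at *
      generalize b * j % r = B1 at *
      generalize c * j % r = C1 at *
      generalize d * j % r = D1 at *
      generalize e * j % r = E1 at *
      omega
  rcases cases with hi | ⟨he0, hc0, hd0⟩
  · have hA0 := ap k₀ h01 h02
    have hB0 := bp k₀ h01 h02
    have hE0 := lt e k₀
    -- the vector β + e₁
    obtain ⟨p', hp'⟩ : ∃ p' : Fin 4 → ℤ,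
      p' = ![a * k₀ % r + r, b * k₀ % r, c * k₀ % r, d * k₀ % r] := ⟨_, rfl⟩
    have p'n : ∀ i, 0 ≤ p' i := by
      intro i; rw [hp']; fin_cases i <;> simp [nn]
      have := nn a k₀; linarith
    have p'd : ∀ i, r ∣ p' i - k₀ * ![a, b, c, d] i := by
      intro i
      have := pkd k₀ i
      rw [hp']
      fin_cases i
      · have h := dvd_add this (dvd_refl r)
        simp [pk] at h ⊢
        have e1 : a * k₀ % r + r - k₀ * a = a * k₀ % r - k₀ * a + r := by abel
        rw [e1, dvd_add_self_right]; exact h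
      · simpa [pk] using this
      · simpa [pk] using this
      · simpa [pk] using this
    have p'B : vec r p' ∉ B := by
      intro h
      have h3 := vec_inj r hr _ _ (hI.1 h h0B) 0
      rw [hp'] at h3
      simp [pk] at h3
      linarith
    obtain ⟨m₁, hm₁, -, hm₁'⟩ := rule_out r a b c d k₀ δ S B hr hS hI p' p'n p'd
      (by rw [hp']; simpa using hB0) (by rw [hp']; simpa using lt b k₀) p'B
    have hw1 := hwt k₀ p' p'd m₁ hm₁
    have hw0 := wt_nonneg p' p'n m₁
    have hsum' : p' 0 + p' 1 + p' 2 + p' 3 = e * k₀ % r + k₀ + r := by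
      rw [hp']; simp; linarith
    have hwE' : wt p' m₁ = e * k₀ % r := by
      rcases two_vals r _ hw1 (by linarith) (by linarith) with h | h <;> linarith
    have hm₁ne : m₁ ≠ ![1, 1, 0, 0] := by
      intro h
      rw [h, hp'] at hwE'
      simp [wt] at hwE'
      linarith
    obtain ⟨e0, e1, e2⟩ := hF.2 m₁ hm₁ hm₁ne
    rw [hp'] at hwE'
    simp [wt, e0, e1] at hwE'
    have hfl : ∀ (m : ℕ) (X : ℤ), ⌊(m:ℝ) * ((X:ℝ) / r)⌋ = ((m:ℤ) * X) / r := by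
      intro m X
      rw [← floor_div' _ _ hr]
      congr 1
      push_cast; ring
    refine hcore ((a * k₀ % r : ℤ) / r) ((b * k₀ % r : ℤ) / r) ((c * k₀ % r : ℤ) / r)
      ((d * k₀ % r : ℤ) / r) ((j : ℝ) / r) (m₁ 2) (m₁ 3) ?_ ?_ ?_ ?_ ?_ ?_ ?_ ?_ ?_ e2 ?_
    · apply div_pos _ hrR; exact_mod_cast hA0
    · apply div_pos _ hrR; exact_mod_cast hB0
    · apply div_nonneg _ hrR.le; exact_mod_cast nn c k₀
    · apply div_nonneg _ hrR.le; exact_mod_cast nn d k₀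
    · apply div_pos _ hrR; exact_mod_cast hj1
    · rw [div_mul_eq_mul_div, div_lt_one hrR]; exact_mod_cast hjN
    · rw [← add_div, div_lt_one hrR]
      have : a * k₀ % r + b * k₀ % r < r := by linarith
      exact_mod_cast this
    · rw [← add_div, eq_sub_iff_add_eq, ← add_div, div_eq_one_iff_eq hrR.ne']
      have : c * k₀ % r + d * k₀ % r + j = r := by linarith
      exact_mod_cast this
    · rw [← add_div, ← mul_div_assoc, ← mul_div_assoc, ← add_div]
      congr 1
      have : (m₁ 2 : ℤ) * (c * k₀ % r) + (m₁ 3 : ℤ) * (d * k₀ % r) = a * k₀ % r + b * k₀ % r := by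
        linarith
      exact_mod_cast this
    · intro m hm2 hmN
      have hmN' : ((m:ℤ) + 1) * j < r := by
        have : (m:ℤ) + 1 ≤ N := by exact_mod_cast hmN
        nlinarith
      have hm2' : (2:ℤ) ≤ m := by exact_mod_cast hm2
      have b1 : 2 * j ≤ m * j := by nlinarith
      have hcc := hconc (r - m * j) (by linarith) (by linarith) (by intro h; linarith)
        (by intro h; linarith)
      have tr : ∀ u : ℤ, u * (r - m * j) % r = (m * (u * k₀ % r)) - r * ((m * (u * k₀ % r)) / r) := by
        intro u
        rw [← Int.emod_def]
        apply Int.ModEq.symm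
        apply Int.modEq_iff_dvd.2
        have : u * (r - m * j) - m * (u * k₀ % r) = r * (u - u * m) + m * (u * k₀ - u * k₀ % r) := by
          rw [hj]; ring
        rw [this]
        exact dvd_add (dvd_mul_right _ _) ((dvd_emod _ _).mul_left _)
      rw [tr a, tr b, tr c, tr d, tr e] at hcc
      unfold HH
      rw [← add_div, ← Int.cast_add, hi]
      rw [hfl, hfl, hfl, hfl, hfl]
      apply mul_left_cancel₀ hr.ne'
      have x1 : (m:ℤ) * (a * k₀ % r) + m * (b * k₀ % r) = m * (e * k₀ % r) := by
        rw [← mul_add, hi]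
      have x2 : (m:ℤ) * (c * k₀ % r) + m * (d * k₀ % r) = m * r - m * j := by
        rw [← mul_add, hcd0, hj]; ring
      linear_combination x1 + x2 - hcc
  · have hdeg : ∀ n : ℤ, 2 ≤ n → n ≤ 3 → r ∣ n * (c * k₀ % r) ∨ r ∣ n * (d * k₀ % r) := by
      intro n hn2 hn3
      have b1 : 2 * j ≤ n * j := by nlinarith
      have b2 : n * j ≤ 3 * j := by nlinarith
      have q1 := hconc (n * j) (by linarith) (by linarith) (by intro h; linarith)
        (by intro h; linarith)
      have q2 := hconc (r - n * j) (by linarith) (by linarith) (by intro h; linarith)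
        (by intro h; linarith)
      have hE : e * (n * j) % r = 0 := by
        apply Int.emod_eq_zero_of_dvd
        have h1 : r ∣ e * k₀ := Int.dvd_of_emod_eq_zero he0
        have : e * (n * j) = r * (e * n) - n * (e * k₀) := by rw [hj]; ring
        rw [this]; exact dvd_sub (dvd_mul_right _ _) (h1.mul_left _)
      have tr : ∀ u : ℤ, u * (n * j) % r = 0 → r ∣ n * (u * k₀ % r) := by
        intro u hu
        have h1 : r ∣ u * (n * j) := Int.dvd_of_emod_eq_zero hu
        have : n * (u * k₀ % r) = r * (u * n) - u * (n * j) - n * (u * k₀ - u * k₀ % r) := by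
          rw [hj]; ring
        rw [this]
        exact dvd_sub (dvd_sub (dvd_mul_right _ _) h1) ((dvd_emod _ _).mul_left _)
      have ha := ap (n * j) (by linarith) (by linarith)
      have hb := bp (n * j) (by linarith) (by linarith)
      rcases compl r a (n * j) hr with ⟨ha0, ha'⟩ | ⟨ha0, ha'⟩
      · linarith
      rcases compl r b (n * j) hr with ⟨hb0, hb'⟩ | ⟨hb0, hb'⟩
      · linarith
      rcases compl r c (n * j) hr with ⟨hc0, hc'⟩ | ⟨hc0, hc'⟩
      · exact Or.inl (tr c hc0)
      rcases compl r d (n * j) hr with ⟨hd0, hd'⟩ | ⟨hd0, hd'⟩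
      · exact Or.inr (tr d hd0)
      rcases compl r e (n * j) hr with ⟨he0, he'⟩ | ⟨he0, he'⟩
      · exfalso; linarith
      · linarith
    have two : ∀ x : ℤ, 0 < x → x < r → r ∣ 2 * x → 2 * x = r := by
      intro x h1 h2 h3
      rcases two_vals r _ h3 (by linarith) (by linarith) with h | h <;> linarith
    have three : ∀ x : ℤ, 0 < x → x < r → r ∣ 3 * x → 3 * x = r ∨ 3 * x = 2 * r := by
      intro x h1 h2 h3
      have h4 : r ∣ 3 * x - r := dvd_sub h3 (dvd_refl r)
      rcases two_vals r _ h4 (by linarith) (by linarith) with h | h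
      · left; linarith
      · right; linarith
    have lc := lt c k₀
    have ld := lt d k₀
    rcases hdeg 2 (by norm_num) (by norm_num) with h2 | h2 <;>
    rcases hdeg 3 (by norm_num) (by norm_num) with h3 | h3
    · have := two _ hc0 lc h2
      rcases three _ hc0 lc h3 with h | h <;> linarith
    · have := two _ hc0 lc h2
      rcases three _ hd0 ld h3 with h | h <;> linarith
    · have := two _ hd0 ld h2
      rcases three _ hc0 lc h3 with h | h <;> linarith
    · have := two _ hd0 ld h2
      rcases three _ hd0 ld h3 with h | h <;> linarith

/-- Proposition (xy), part (4), in the cA case. -/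
theorem statement10 :
    ∃ δstar : ℝ, 0 < δstar ∧ δstar ≤ 1 / 13 ∧
      ∀ (r : ℤ) (δ : ℝ) (a b c d e : ℤ) (S : Set (Fin 4 → ℕ)) (B : Set (Fin 4 → ℚ)),
        13 < r → 0 < δ → δ ≤ δstar →
        WeightCond r a b c d e S → RuleI r a b c d δ S B → RuleII r a b c d e →
        FormCA S →
        ∀ k : ℤ, 1 ≤ k → k ≤ r - 1 →
          res r (a * k) + res r (b * k) + res r (c * k) + res r (d * k)
            = res r (e * k) + k + r := by
  obtain ⟨N, hN, hcore⟩ := core_s10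
  have hNR : (13:ℝ) ≤ N := by exact_mod_cast hN
  refine ⟨1 / N, by positivity, one_div_le_one_div_of_le (by norm_num) hNR, ?_⟩
  intro r δ a b c d e S B hr _ hδ hW hI hII hF k hk1 hk2
  exact main_arith N hN hcore r δ a b c d e S B hr hδ hW hI hII hF k hk1 hk2

end GapPaper
end

section
/- There exists a real constant $\delta^*$ with $0<\delta^*\leq 1/13$ such that, in the hyperquotient setup with $\delta\leq\delta^*$, with the square form and Rules I and II, one of the following holds, after possibly permuting $b,c,d$: (a) $a\equiv e\equiv 0 \pmod r$ and $b,c,d$ are each coprime to $r$; (b) $r$ is odd and $a,b,c,d,e$ are each coprime to $r$; (c) $\gcd(d,r)=\gcd(e,r)=2$ and $a,b,c$ are each coprime to $r$. -/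
open scoped BigOperators

namespace GapPaper

lemma dvd_cg {s x y : ℤ} (h : s ∣ x) (e : x = y) : s ∣ y := e ▸ h

lemma dist_sum (g s b k : ℤ) (hg : 0 < g) (hs : 0 < s) (hb : IsCoprime b g) :
    2 * ∑ j ∈ Finset.range g.toNat, (b * (k + (j:ℤ) * s)) % (g * s)
      = 2 * ((b * (g * k)) % (g * s)) + (g * s) * (g - 1) := by
  obtain ⟨n, rfl⟩ : ∃ n : ℕ, g = n := ⟨g.toNat, by omega⟩
  simp only [Int.toNat_natCast]
  have h1 : ∀ j : ℕ, (b * (k + (j:ℤ) * s)) % (n * s)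
      = (b * k) % s + s * (((b * k) / s + b * j) % n) := by
    intro j
    set Q := (b * k) / s
    set ρ := (b * k) % s
    have e1 : b * k = s * Q + ρ := (Int.mul_ediv_add_emod _ _).symm
    have hρ0 : 0 ≤ ρ := Int.emod_nonneg _ hs.ne'
    have hρ1 : ρ < s := Int.emod_lt_of_pos _ hs
    have e2 := Int.mul_ediv_add_emod (Q + b * j) n
    have hm0 : 0 ≤ (Q + b * j) % n := Int.emod_nonneg _ hg.ne'
    have hm1 : (Q + b * j) % n < n := Int.emod_lt_of_pos _ hg
    set M := (Q + b * j) % n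
    set P := (Q + b * j) / n
    have e3 : b * (k + (j:ℤ) * s) = (ρ + s * M) + (n * s) * P := by
      have : b * (k + (j:ℤ) * s) = b * k + s * (b * j) := by ring
      rw [this, e1]
      have : b * (j:ℤ) = n * P + M - Q := by linarith
      rw [this]; ring
    rw [e3, Int.add_mul_emod_self_left]
    apply Int.emod_eq_of_lt
    · positivity
    · nlinarith
  have h2 : (b * ((n:ℤ) * k)) % (n * s) = n * ((b * k) % s) := by
    rw [show b * ((n:ℤ) * k) = n * (b * k) by ring, Int.mul_emod_mul_of_pos _ _ hg]
  have h3 : ∑ j ∈ Finset.range n, (((b * k) / s + b * (j:ℤ)) % n) = ∑ j ∈ Finset.range n, (j:ℤ) := by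
    set Q := (b * k) / s
    have hmaps : ∀ j ∈ Finset.range n, ((Q + b * (j:ℤ)) % n).toNat ∈ Finset.range n := by
      intro j _
      have hm0 : 0 ≤ (Q + b * j) % n := Int.emod_nonneg _ hg.ne'
      have hm1 : (Q + b * j) % n < n := Int.emod_lt_of_pos _ hg
      rw [Finset.mem_range]; omega
    have hinj : Set.InjOn (fun j : ℕ => ((Q + b * (j:ℤ)) % n).toNat) (Finset.range n) := by
      intro i hi j hj h
      simp only [Finset.coe_range, Set.mem_Iio] at hi hj
      have hm0 : 0 ≤ (Q + b * j) % n := Int.emod_nonneg _ hg.ne'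
      have hm1 : 0 ≤ (Q + b * i) % n := Int.emod_nonneg _ hg.ne'
      have h' : (Q + b * i) % n = (Q + b * j) % n := by simp only at h; omega
      have hd : (n:ℤ) ∣ b * ((i:ℤ) - j) := by
        have h2 : (n:ℤ) ∣ (Q + b * i) - (Q + b * j) := Int.ModEq.dvd (h' : Int.ModEq _ _ _).symm
        have h3 : (Q + b * i) - (Q + b * j) = b * ((i:ℤ) - j) := by ring
        rwa [h3] at h2
      have hd2 : (n:ℤ) ∣ (i:ℤ) - j := hb.symm.dvd_of_dvd_mul_left hd
      obtain ⟨t, ht⟩ := hd2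
      have : t = 0 := by
        by_contra hne
        rcases lt_or_gt_of_ne hne with h0 | h0
        · nlinarith
        · nlinarith
      subst this
      omega
    refine Finset.sum_nbij (fun j : ℕ => ((Q + b * (j:ℤ)) % n).toNat) hmaps hinj
      (Finset.surjOn_of_injOn_of_card_le _ hmaps hinj le_rfl) ?_
    intro j _
    have hm0 : 0 ≤ (Q + b * j) % n := Int.emod_nonneg _ hg.ne'
    omega
  have h4 : (∑ j ∈ Finset.range n, (j:ℤ)) * 2 = n * (n - 1) := by
    have := Finset.sum_range_id_mul_two n
    have h := congrArg (Nat.cast : ℕ → ℤ) this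
    push_cast at h
    rw [h, Nat.cast_sub (by omega)]; simp
  rw [Finset.sum_congr rfl (fun j _ => h1 j), Finset.sum_add_distrib, ← Finset.mul_sum, h3, h2]
  simp only [Finset.sum_const, Finset.card_range, nsmul_eq_mul]
  linear_combination s * h4

/-- key local analysis -/
lemma key_s12 (r A B C D K F A' B' C' D' F' : ℤ) (hr : 0 < r) (hA : 0 ≤ A) (hAr : A < r)
    (hB : 0 < B) (hBr : B < r) (hC : 0 < C) (hCr : C < r) (hD : 0 < D) (hDr : D < r)
    (hK : 0 < K) (hKr : K < r)
    (hA' : (A = 0 ∧ A' = 0) ∨ (0 < A ∧ A' = r - A)) (hB' : B' = r - B) (hC' : C' = r - C)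
    (hD' : D' = r - D) (hcong : r ∣ B + C + D - A - K)
    (hF0 : 0 ≤ F) (hF2 : F ≤ 2 * A) (hFd : r ∣ F - 2 * A)
    (hF0' : 0 ≤ F') (hF2' : F' ≤ 2 * A') (hFd' : r ∣ F' - 2 * A')
    (h : r < A + B + C + D - F) (h' : r < A' + B' + C' + D' - F') :
    (2 * A < r → B + C + D - K - r = A) ∧
    |2 * (B + C + D - K - r)| ≤ r ∧ (2 * A = r → F = r → F' = r → False) := by
  obtain ⟨p, hp⟩ := hFd
  obtain ⟨p', hp'⟩ := hFd'
  obtain ⟨q, hq⟩ := hcong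
  have b1 : -2 < p := by nlinarith
  have b2 : p ≤ 0 := by nlinarith
  have hAr' : A' < r := by omega
  have b1' : -2 ≤ p' := by nlinarith
  have b2' : p' ≤ 0 := by nlinarith
  have b3 : -2 < q := by nlinarith
  have b4 : q < 3 := by nlinarith
  rw [abs_le]
  have p1 : p = -1 ∨ p = 0 := by omega
  have p2 : p' = -2 ∨ p' = -1 ∨ p' = 0 := by omega
  have p3 : q = -1 ∨ q = 0 ∨ q = 1 ∨ q = 2 := by omega
  rcases p1 with rfl | rfl <;> rcases p2 with rfl | rfl | rfl <;>
    rcases p3 with rfl | rfl | rfl | rfl <;> omega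


/-- the balanced sum -/
def TT (r b c d k : ℤ) : ℤ := (b*k)%r + (c*k)%r + (d*k)%r - k%r - r

lemma TT_bound (r b c d k : ℤ) (hr : 0 < r) : |TT r b c d k| < 2 * r := by
  unfold TT
  have := Int.emod_nonneg (b*k) hr.ne'
  have := Int.emod_nonneg (c*k) hr.ne'
  have := Int.emod_nonneg (d*k) hr.ne'
  have := Int.emod_nonneg (k) hr.ne'
  have := Int.emod_lt_of_pos (b*k) hr
  have := Int.emod_lt_of_pos (c*k) hr
  have := Int.emod_lt_of_pos (d*k) hr
  have := Int.emod_lt_of_pos (k) hr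
  rw [abs_lt]; omega

lemma TT_sum (g s b c d k : ℤ) (hg : 0 < g) (hs : 0 < s) (hb : IsCoprime b g)
    (hc : IsCoprime c g) (hd : IsCoprime d g) :
    ∑ j ∈ Finset.range g.toNat, TT (g*s) b c d (k + (j:ℤ) * s) = TT (g*s) b c d (g*k) := by
  have h1 := dist_sum g s b k hg hs hb
  have h2 := dist_sum g s c k hg hs hc
  have h3 := dist_sum g s d k hg hs hd
  have h4 := dist_sum g s 1 k hg hs isCoprime_one_left
  simp only [one_mul] at h4
  unfold TT
  rw [Finset.sum_sub_distrib, Finset.sum_sub_distrib, Finset.sum_add_distrib,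
    Finset.sum_add_distrib]
  simp only [Finset.sum_const, Finset.card_range, nsmul_eq_mul]
  have : ((g.toNat : ℕ) : ℤ) = g := by omega
  rw [this]
  linarith

lemma emod_neg_of (r x : ℤ) (hr : 0 < r) (h : ¬ r ∣ x) : 0 < x % r ∧ (-x) % r = r - x % r := by
  have h0 := Int.emod_nonneg x hr.ne'
  have h1 := Int.emod_lt_of_pos x hr
  have h2 : x % r ≠ 0 := fun h' => h (Int.dvd_of_emod_eq_zero h')
  refine ⟨by omega, ?_⟩
  have e := Int.mul_ediv_add_emod x r
  have : -x = (r - x % r) + r * (-(x/r) - 1) := by linarith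
  rw [this, Int.add_mul_emod_self_left]
  apply Int.emod_eq_of_lt <;> omega

/-- arithmetic consequences of the rules -/
structure Data (r a b c d : ℤ) (Bad : ℤ → Prop) : Prop where
  hb : ∀ k, r ∣ b * k → r ∣ 2 * k
  hc : ∀ k, r ∣ c * k → r ∣ 2 * k
  hd : ∀ k, r ∣ d * k → r ∣ 2 * k
  hsum : r ∣ b + c + d - a - 1
  hbad : ∀ k l, Bad k → Bad l → r ∣ k - l
  hbig : ∀ k, Bad k → 1000 < r
  hF : ∀ k, ¬ r ∣ 2 * k → ∃ F : ℤ, 0 ≤ F ∧ F ≤ 2 * ((a*k)%r) ∧ r ∣ F - 2 * ((a*k)%r) ∧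
    (0 < (a*k)%r → 0 < F) ∧ (¬ Bad k → r < (a*k)%r + (b*k)%r + (c*k)%r + (d*k)%r - F)

lemma good {r a b c d : ℤ} {Bad : ℤ → Prop} (hr : 0 < r) (H : Data r a b c d Bad) (k : ℤ)
    (hk : ¬ r ∣ 2 * k) (h1 : ¬ Bad k) (h2 : ¬ Bad (-k)) :
    (2 * ((a*k)%r) < r → TT r b c d k = (a*k)%r) ∧ |2 * TT r b c d k| ≤ r ∧
    2 * ((a*k)%r) ≠ r := by
  obtain ⟨F, f0, f1, f2, f3, f4⟩ := H.hF k hk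
  obtain ⟨F', f0', f1', f2', f3', f4'⟩ := H.hF (-k) (by
    rw [mul_neg, dvd_neg]; exact hk)
  specialize f4 h1
  specialize f4' h2
  have gb := emod_neg_of r (b*k) hr (fun h => hk (H.hb k h))
  have gc := emod_neg_of r (c*k) hr (fun h => hk (H.hc k h))
  have gd := emod_neg_of r (d*k) hr (fun h => hk (H.hd k h))
  have gk := emod_neg_of r k hr (fun h => hk (h.mul_left 2))
  simp only [mul_neg] at f1' f2' f3' f4'
  have ga : ((a*k)%r = 0 ∧ (-(a*k))%r = 0) ∨ (0 < (a*k)%r ∧ (-(a*k))%r = r - (a*k)%r) := by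
    by_cases h : r ∣ a*k
    · left; exact ⟨Int.emod_eq_zero_of_dvd h, Int.emod_eq_zero_of_dvd ((dvd_neg).2 h)⟩
    · right; exact emod_neg_of r _ hr h
  have hcong : r ∣ (b*k)%r + (c*k)%r + (d*k)%r - (a*k)%r - k%r := by
    have e1 := Int.mul_ediv_add_emod (b*k) r
    have e2 := Int.mul_ediv_add_emod (c*k) r
    have e3 := Int.mul_ediv_add_emod (d*k) r
    have e4 := Int.mul_ediv_add_emod (a*k) r
    have e5 := Int.mul_ediv_add_emod k r
    obtain ⟨t, ht⟩ := H.hsum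
    refine ⟨t * k - b*k/r - c*k/r - d*k/r + a*k/r + k/r, ?_⟩
    linear_combination e1 + e2 + e3 - e4 - e5 + k * ht
  have la := Int.emod_lt_of_pos (a*k) hr
  have la0 := Int.emod_nonneg (a*k) hr.ne'
  obtain ⟨k1, k2, k3⟩ := key_s12 r _ _ _ _ _ F _ _ _ _ F' hr la0
    la gb.1 (Int.emod_lt_of_pos _ hr) gc.1
    (Int.emod_lt_of_pos _ hr) gd.1 (Int.emod_lt_of_pos _ hr) gk.1 (Int.emod_lt_of_pos _ hr) ga
    gb.2 gc.2 gd.2 hcong f0 f1 f2 f0' f1' f2' f4 f4'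
  refine ⟨k1, k2, fun h => k3 h ?_ ?_⟩
  · rw [h] at f1 f2
    obtain ⟨p, hp⟩ := f2
    have := f3 (by omega)
    have : -1 < p := by nlinarith
    have : p < 1 := by nlinarith
    have : p = 0 := by omega
    subst this; omega
  · have h' : (-(a*k))%r = (a*k)%r := by omega
    rw [h'] at f1' f2' f3'
    rw [h] at f1' f2'
    obtain ⟨p, hp⟩ := f2'
    have := f3' (by omega)
    have : -1 < p := by nlinarith
    have : p < 1 := by nlinarith
    have : p = 0 := by omega
    subst this; omega

lemma small_dvd (g : ℤ) (i j : ℕ) (hi : (i:ℤ) < g) (hj : (j:ℤ) < g) (h : g ∣ (i:ℤ) - j) :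
    i = j := by
  have := Int.eq_zero_of_abs_lt_dvd h (by rw [abs_lt]; omega)
  omega

lemma count_le (g s x : ℤ) (hg : 0 < g) (hs : 0 < s) :
    (∑ j ∈ Finset.range g.toNat, if g * s ∣ x + (j:ℤ) * s then (1:ℤ) else 0) ≤ 1 := by
  rw [Finset.sum_boole]
  have : (Finset.filter (fun j : ℕ => g * s ∣ x + (j:ℤ) * s) (Finset.range g.toNat)).card ≤ 1 := by
    rw [Finset.card_le_one]
    intro i hi j hj
    simp only [Finset.mem_filter, Finset.mem_range] at hi hj
    have h := dvd_sub hi.2 hj.2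
    have h2 : g * s ∣ ((i:ℤ) - j) * s := by
      exact dvd_cg (h) (by ring)
    exact small_dvd g i j (by omega) (by omega) (Int.dvd_of_mul_dvd_mul_right hs.ne' h2)
  exact_mod_cast this

section core
variable {g s a b c d : ℤ} {Bad : ℤ → Prop}

lemma Aval (hg : 0 < g) {k u : ℤ} (hu0 : 0 ≤ u) (hus : u < s) (hk : s ∣ a * k - u)
    (j : ℤ) : (g * a * (k + j * s)) % (g * s) = g * u := by
  rw [mul_assoc, Int.mul_emod_mul_of_pos _ _ hg]
  congr 1
  obtain ⟨t, ht⟩ := hk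
  rw [show a * (k + j * s) = u + s * (t + a * j) by linear_combination ht,
    Int.add_mul_emod_self_left]
  exact Int.emod_eq_of_lt hu0 hus

lemma ndvd {k u : ℤ} (hu0 : 0 < u) (hus : 2 * u < s) (hk : s ∣ a * k - u) : ¬ s ∣ 2 * k := by
  intro h
  have h1 : s ∣ a * (2 * k) - 2 * (a * k - u) := dvd_sub (h.mul_left _) (hk.mul_left _)
  have h2 : a * (2 * k) - 2 * (a * k - u) = 2 * u := by ring
  rw [h2] at h1
  have := Int.le_of_dvd (by omega) h1
  omega

lemma goodcase (hg : 0 < g) (hs : 0 < s) (hb : IsCoprime b g) (hc : IsCoprime c g)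
    (hd : IsCoprime d g) (H : Data (g*s) (g*a) b c d Bad) {k u : ℤ} (hu0 : 0 < u)
    (hus : 2 * u < s) (hk : s ∣ a * k - u)
    (h1 : ∀ j : ℤ, ¬ Bad (k + j * s) ∧ ¬ Bad (-(k + j * s)))
    (h2 : ¬ Bad (g * k) ∧ ¬ Bad (-(g * k))) : 2 * g * u ≤ s := by
  have hr : 0 < g * s := by positivity
  have hn := ndvd hu0 hus hk
  have hT : ∀ j : ℕ, TT (g*s) b c d (k + (j:ℤ) * s) = g * u := by
    intro j
    have hA := Aval hg hu0.le (by omega : u < s) hk (j:ℤ)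
    have := (good hr H (k + (j:ℤ) * s) (by
      intro h
      apply hn
      have h3 : s ∣ 2 * (k + (j:ℤ) * s) := (dvd_mul_left s g).trans h
      have h4 : 2 * (k + (j:ℤ) * s) = 2 * k + s * (2 * j) := by ring
      rw [h4] at h3
      exact (dvd_add_left (dvd_mul_right _ _)).1 h3) (h1 j).1 (h1 j).2).1
    rw [hA] at this
    exact this (by nlinarith)
  have hsum := TT_sum g s b c d k hg hs hb hc hd
  rw [Finset.sum_congr rfl (fun j _ => hT j)] at hsum
  simp only [Finset.sum_const, Finset.card_range, nsmul_eq_mul] at hsum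
  have hgn : ((g.toNat : ℕ) : ℤ) = g := by omega
  rw [hgn] at hsum
  have := (good hr H (g * k) (by
      intro h
      apply hn
      have h4 : 2 * (g * k) = g * (2 * k) := by ring
      rw [h4] at h
      exact Int.dvd_of_mul_dvd_mul_left hg.ne' h) h2.1 h2.2).2.1
  rw [← hsum, abs_le] at this
  have h5 : g * (2 * g * u) ≤ g * s := by linarith [this.2]
  exact le_of_mul_le_mul_left h5 hg

lemma crude (hg : 0 < g) (hs : 0 < s) (hb : IsCoprime b g) (hc : IsCoprime c g)
    (hd : IsCoprime d g) (H : Data (g*s) (g*a) b c d Bad) {k u k0 : ℤ} (hu0 : 0 < u)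
    (hus : 2 * u < s) (hk : s ∣ a * k - u) (hk0 : Bad k0) : g * u ≤ 8 * s := by
  have hr : 0 < g * s := by positivity
  have hn := ndvd hu0 hus hk
  have hgu : 0 < g * u := by positivity
  have hgu2 : g * u < g * s := by nlinarith
  have hT : ∀ j : ℕ, g * u - TT (g*s) b c d (k + (j:ℤ) * s) ≤
      3 * (g * s) * ((if g * s ∣ (k - k0) + (j:ℤ) * s then (1:ℤ) else 0) +
        (if g * s ∣ (k + k0) + (j:ℤ) * s then (1:ℤ) else 0)) := by
    intro j
    have hbd := abs_lt.1 (TT_bound (g*s) b c d (k + (j:ℤ) * s) hr)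
    by_cases c1 : g * s ∣ (k - k0) + (j:ℤ) * s
    · rw [if_pos c1]
      split_ifs <;> linarith
    by_cases c2 : g * s ∣ (k + k0) + (j:ℤ) * s
    · rw [if_pos c2, if_neg c1]
      linarith
    rw [if_neg c1, if_neg c2]
    have hA := Aval hg hu0.le (by omega : u < s) hk (j:ℤ)
    have := (good hr H (k + (j:ℤ) * s) (by
      intro h
      apply hn
      have h3 : s ∣ 2 * (k + (j:ℤ) * s) := (dvd_mul_left s g).trans h
      have h4 : 2 * (k + (j:ℤ) * s) = 2 * k + s * (2 * j) := by ring
      rw [h4] at h3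
      exact (dvd_add_left (dvd_mul_right _ _)).1 h3)
      (fun hB => c1 (by
        have := H.hbad _ _ hB hk0
        exact dvd_cg (this) (by ring)))
      (fun hB => c2 (by
        have := H.hbad _ _ hk0 hB
        exact dvd_cg (this) (by ring)))).1
    rw [hA] at this
    rw [this (by nlinarith)]; simp
  have hsum := TT_sum g s b c d k hg hs hb hc hd
  have hle := Finset.sum_le_sum (s := Finset.range g.toNat) (fun j _ => hT j)
  rw [← Finset.mul_sum, Finset.sum_add_distrib, Finset.sum_sub_distrib, hsum] at hle
  simp only [Finset.sum_const, Finset.card_range, nsmul_eq_mul] at hle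
  have hgn : ((g.toNat : ℕ) : ℤ) = g := by omega
  rw [hgn] at hle
  have c1 := count_le g s (k - k0) hg hs
  have c2 := count_le g s (k + k0) hg hs
  have hbd := abs_lt.1 (TT_bound (g*s) b c d (g*k) hr)
  have h5 : g * (g * u) ≤ g * (8 * s) := by nlinarith
  exact le_of_mul_le_mul_left h5 hg

lemma two_case (hg : 7 ≤ g) (ha : IsCoprime a 2) (H : Data (g*2) (g*a) b c d Bad) : False := by
  have hr : 0 < g * 2 := by positivity
  have hodd : a % 2 = 1 := by
    rcases Int.emod_two_eq_zero_or_one a with h | h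
    · have h2 : (2:ℤ) ∣ a := Int.dvd_of_emod_eq_zero h
      have := ha.isUnit_of_dvd' h2 dvd_rfl
      rw [Int.isUnit_iff] at this
      omega
    · exact h
  have main : ∀ k : ℤ, k = 1 ∨ k = 3 → ¬ Bad k → ¬ Bad (-k) → False := by
    intro k hk h1 h2
    refine (good hr H k ?_ h1 h2).2.2 ?_
    · intro h
      have := Int.le_of_dvd (by omega) h
      omega
    · rw [mul_assoc, Int.mul_emod_mul_of_pos _ _ (by omega)]
      have : (a * k) % 2 = 1 := by rcases hk with rfl | rfl <;> omega
      rw [this]; ring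
  by_cases hB : Bad 1 ∨ Bad (-1)
  · apply main 3 (Or.inr rfl)
    · intro h3
      rcases hB with h | h
      · have := Int.le_of_dvd (by omega) (H.hbad _ _ h3 h); omega
      · have := Int.le_of_dvd (by omega) (H.hbad _ _ h3 h); omega
    · intro h3
      rcases hB with h | h
      · have := Int.le_of_dvd (by omega) (H.hbad _ _ h h3); omega
      · have := Int.le_of_dvd (by omega) (H.hbad _ _ h h3); omega
  · push Not at hB
    exact main 1 (Or.inl rfl) hB.1 hB.2

lemma uniq {u u' p : ℤ} (h0 : 0 < u) (h1 : 2 * u < s) (h0' : 0 < u') (h1' : 2 * u' < s)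
    (h : s ∣ u - p ∨ s ∣ u + p) (h' : s ∣ u' - p ∨ s ∣ u' + p) : u = u' := by
  have : s ∣ u - u' ∨ s ∣ u + u' := by
    rcases h with h | h <;> rcases h' with h' | h'
    · left; exact dvd_cg (dvd_sub h h') (by ring)
    · right; exact dvd_cg (dvd_add h h') (by ring)
    · right; exact dvd_cg (dvd_add h h') (by ring)
    · left; exact dvd_cg (dvd_sub h h') (by ring)
  rcases this with h | h
  · have := Int.eq_zero_of_abs_lt_dvd h (by rw [abs_lt]; omega)
    omega
  · have := Int.le_of_dvd (by omega) h
    omega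

lemma core_false (hg : 2 ≤ g) (hs : 2 ≤ s) (hr13 : 13 < g * s) (ha : IsCoprime a s)
    (hb : IsCoprime b g) (hc : IsCoprime c g)
    (hd : IsCoprime d g) (H : Data (g*s) (g*a) b c d Bad) : False := by
  have hg0 : 0 < g := by omega
  have hs0 : 0 < s := by omega
  rcases hs.eq_or_lt with h2 | hs3
  · subst h2
    exact two_case (by omega) ha H
  have pick : ∀ u : ℤ, ∃ k, s ∣ a * k - u := by
    intro u
    obtain ⟨x, y, hxy⟩ := ha
    exact ⟨x * u, -(y * u), by linear_combination u * hxy⟩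
  by_cases hB : ∃ k0, Bad k0
  · obtain ⟨k0, hk0⟩ := hB
    have hbig := H.hbig k0 hk0
    by_cases hs20 : s < 20
    · obtain ⟨k, hk⟩ := pick ((s-1)/2)
      have := crude hg0 hs0 hb hc hd H (by omega) (by omega) hk hk0
      have h4 : s ≤ 4 * ((s-1)/2) := by omega
      have h5 : 50 < g := by nlinarith
      nlinarith
    · -- choose a good candidate
      obtain ⟨l, hl⟩ : ∃ l, ∀ x, k0 = g * x → x = l := by
        by_cases h : ∃ x, k0 = g * x
        · obtain ⟨x, hx⟩ := h
          exact ⟨x, fun y hy => mul_left_cancel₀ hg0.ne' (hy.symm.trans hx)⟩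
        · exact ⟨0, fun x hx => (h ⟨x, hx⟩).elim⟩
      have step : ∀ u : ℤ, 0 < u → 2 * u < s → s < 4 * u →
          (s ∣ u - a * k0 ∨ s ∣ u + a * k0) ∨ (s ∣ u - a * l ∨ s ∣ u + a * l) := by
        intro u hu0 hu1 hu2
        by_contra hcon
        push Not at hcon
        obtain ⟨⟨n1, n2⟩, n3, n4⟩ := hcon
        obtain ⟨k, hk⟩ := pick u
        have := goodcase hg0 hs0 hb hc hd H hu0 hu1 hk ?_ ?_
        · nlinarith
        · intro j
          constructor
          · intro h
            apply n1
            have h1 : s ∣ k + j * s - k0 := (dvd_mul_left s g).trans (H.hbad _ _ h hk0)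
            have := dvd_sub (dvd_sub (h1.mul_left a) hk) (dvd_mul_left s (a * j))
            exact dvd_cg (this) (by ring)
          · intro h
            apply n2
            have h1 : s ∣ k0 - -(k + j * s) := (dvd_mul_left s g).trans (H.hbad _ _ hk0 h)
            have := dvd_sub (dvd_sub (h1.mul_left a) hk) (dvd_mul_left s (a * j))
            exact dvd_cg (this) (by ring)
        · constructor
          · intro h
            obtain ⟨t, ht⟩ := H.hbad _ _ h hk0
            have hx := hl (k - s * t) (by linear_combination -ht)
            apply n3
            rw [← hx]
            have := dvd_sub (dvd_mul_right s (a * t)) hk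
            exact dvd_cg (this) (by ring)
          · intro h
            obtain ⟨t, ht⟩ := H.hbad _ _ h hk0
            have hx := hl (-k - s * t) (by linear_combination -ht)
            apply n4
            rw [← hx]
            have := dvd_neg.2 (dvd_add (dvd_mul_right s (a * t)) hk)
            exact dvd_cg (this) (by ring)
      have s0 := step ((s-1)/2) (by omega) (by omega) (by omega)
      have s1 := step ((s-1)/2-1) (by omega) (by omega) (by omega)
      have s2 := step ((s-1)/2-2) (by omega) (by omega) (by omega)
      have U := fun (u u' p : ℤ) h0 h1 h0' h1' h h' =>
        @uniq s u u' p h0 h1 h0' h1' h h'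
      have U01 := fun p => U ((s-1)/2) ((s-1)/2-1) p (by omega) (by omega) (by omega) (by omega)
      have U02 := fun p => U ((s-1)/2) ((s-1)/2-2) p (by omega) (by omega) (by omega) (by omega)
      have U12 := fun p => U ((s-1)/2-1) ((s-1)/2-2) p (by omega) (by omega) (by omega) (by omega)
      rcases s0 with s0 | s0 <;> rcases s1 with s1 | s1 <;> rcases s2 with s2 | s2 <;>
        first
        | (have := U01 _ s0 s1; omega)
        | (have := U02 _ s0 s2; omega)
        | (have := U12 _ s1 s2; omega)
  · push Not at hB
    obtain ⟨k, hk⟩ := pick ((s-1)/2)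
    have := goodcase hg0 hs0 hb hc hd H (by omega) (by omega) hk
      (fun j => ⟨hB _, hB _⟩) ⟨hB _, hB _⟩
    by_cases h4 : s = 4
    · subst h4; norm_num at this; omega
    · have : s < 4 * ((s-1)/2) := by omega
      nlinarith

end core


/-- the integral value of a monomial on `r α_k` -/
def val (r a b c d k : ℤ) (m : Fin 4 → ℕ) : ℤ :=
  (m 0 : ℤ) * ((a*k)%r) + (m 1 : ℤ) * ((b*k)%r) + (m 2 : ℤ) * ((c*k)%r) + (m 3 : ℤ) * ((d*k)%r)

lemma vf_alpha (r a b c d k : ℤ) (hr : 0 < r) (S : Set (Fin 4 → ℕ)) (hS : S.Nonempty) :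
    ∃ m ∈ S, vf S (alphaK r a b c d k) = (val r a b c d k m : ℝ) / r ∧
      ∀ m' ∈ S, val r a b c d k m ≤ val r a b c d k m' := by
  have h0 : ∀ m, 0 ≤ val r a b c d k m := by
    intro m
    have := Int.emod_nonneg (a*k) hr.ne'
    have := Int.emod_nonneg (b*k) hr.ne'
    have := Int.emod_nonneg (c*k) hr.ne'
    have := Int.emod_nonneg (d*k) hr.ne'
    unfold val; positivity
  obtain ⟨m, hm, hmin⟩ := (measure (fun m => (val r a b c d k m).toNat)).wf.has_min S hS
  have hmin' : ∀ m' ∈ S, val r a b c d k m ≤ val r a b c d k m' := by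
    intro m' hm'
    have h1 : ¬ ((val r a b c d k m').toNat < (val r a b c d k m).toNat) := hmin m' hm'
    have := h0 m
    have := h0 m'
    omega
  have hrR : (0:ℝ) < r := by exact_mod_cast hr
  have hval : ∀ m : Fin 4 → ℕ, ∑ i : Fin 4, (m i : ℝ) * ((alphaK r a b c d k i : ℚ) : ℝ)
      = (val r a b c d k m : ℝ) / r := by
    intro m
    simp only [Fin.sum_univ_four, alphaK, val, res]
    simp
    field_simp
  refine ⟨m, hm, ?_, hmin'⟩
  apply IsLeast.csInf_eq
  constructor
  · exact ⟨m, hm, (hval m).symm⟩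
  · rintro x ⟨m', hm', rfl⟩
    rw [hval]
    have : (val r a b c d k m : ℝ) ≤ val r a b c d k m' := by exact_mod_cast hmin' m' hm'
    gcongr

lemma w_alpha (r a b c d k : ℤ) :
    ((w (alphaK r a b c d k) : ℚ) : ℝ) =
      (((a*k)%r + (b*k)%r + (c*k)%r + (d*k)%r : ℤ) : ℝ) / r := by
  simp only [w, Fin.sum_univ_four, alphaK, res]
  simp
  ring

lemma alpha_mem (r a b c d k : ℤ) (hr : 0 < r) :
    alphaK r a b c d k ∈ latN r a b c d ∩ orth := by
  have hrQ : (0:ℚ) < r := by exact_mod_cast hr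
  constructor
  · refine ⟨k, fun i => -((![a, b, c, d] i * k) / r), fun i => ?_⟩
    have e := Int.mul_ediv_add_emod (![a, b, c, d] i * k) r
    have e' : ((r:ℚ) * ((![a, b, c, d] i * k) / r : ℤ) + ((![a, b, c, d] i * k) % r : ℤ))
      = ((k * ![a, b, c, d] i : ℤ) : ℚ) := by
      rw [mul_comm k]
      exact_mod_cast e
    rw [← e']
    simp only [alphaK, res]
    push_cast
    field_simp
    ring
  · intro i
    simp only [alphaK, res]
    have : (0:ℚ) ≤ ((![a, b, c, d] i * k % r : ℤ) : ℚ) := by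
      exact_mod_cast Int.emod_nonneg _ hr.ne'
    positivity

lemma alpha_not_corner (r a b c d k : ℤ) (hr : 0 < r) (h : ¬ r ∣ b * k) :
    alphaK r a b c d k ∉ corners := by
  have hrQ : (0:ℚ) < r := by exact_mod_cast hr
  rintro (h0 | ⟨i, hi⟩)
  · have := congrFun h0 1
    simp only [alphaK, res, Pi.zero_apply, div_eq_zero_iff] at this
    rcases this with h1 | h1
    · apply h
      have h2 : (b * k) % r = 0 := by exact_mod_cast h1
      exact Int.dvd_of_emod_eq_zero h2
    · exact hrQ.ne' h1
  · have := congrFun hi i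
    simp only [alphaK, res, if_true] at this
    rw [div_eq_one_iff_eq hrQ.ne'] at this
    have h1 : (![a, b, c, d] i * k) % r = r := by exact_mod_cast this
    have := Int.emod_lt_of_pos (![a, b, c, d] i * k) hr
    omega

lemma alpha_inj (r a b c d k l : ℤ) (hr : 0 < r) (hab : Int.gcd a (Int.gcd b r) = 1)
    (h : alphaK r a b c d k = alphaK r a b c d l) : r ∣ k - l := by
  have hrQ : (0:ℚ) < r := by exact_mod_cast hr
  have h1 : ∀ i, r ∣ ![a, b, c, d] i * (k - l) := by
    intro i
    have := congrFun h i
    simp only [alphaK, res] at this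
    rw [div_left_inj' hrQ.ne'] at this
    have h2 : (![a, b, c, d] i * k) % r = (![a, b, c, d] i * l) % r := by exact_mod_cast this
    have h3 := Int.ModEq.dvd (h2 : Int.ModEq _ _ _).symm
    exact dvd_cg h3 (by ring)
  have ha : r ∣ a * (k - l) := h1 0
  have hb : r ∣ b * (k - l) := h1 1
  have e1 := Int.gcd_eq_gcd_ab a (Int.gcd b r)
  have e2 := Int.gcd_eq_gcd_ab b r
  rw [hab] at e1
  set x := Int.gcdA a (Int.gcd b r)
  set y := Int.gcdB a (Int.gcd b r)
  have h4 : k - l = (a * (k-l)) * x + (b * (k - l)) * (Int.gcdA b r * y)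
      + r * (Int.gcdB b r * y * (k - l)) := by
    push_cast at e1
    linear_combination (k - l) * e1 + (k - l) * y * e2
  rw [h4]
  exact dvd_add (dvd_add (ha.mul_right _) (hb.mul_right _)) (dvd_mul_right _ _)

lemma gdvd2 (r a b e : ℤ) (h1 : Int.gcd b r ∣ Int.gcd e r) (h2 : Int.gcd a (Int.gcd b r) = 1)
    (he : r ∣ e - 2 * a) : Int.gcd b r ∣ 2 := by
  have hr : ((Int.gcd b r : ℕ) : ℤ) ∣ r := Int.gcd_dvd_right ..
  have hee : ((Int.gcd b r : ℕ) : ℤ) ∣ e := (Int.natCast_dvd_natCast.2 h1).trans (Int.gcd_dvd_left ..)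
  have h3 : ((Int.gcd b r : ℕ) : ℤ) ∣ a * 2 := dvd_cg (dvd_sub hee (hr.trans he)) (by ring)
  have hco : IsCoprime ((Int.gcd b r : ℕ) : ℤ) a := (Int.isCoprime_iff_gcd_eq_one.2 h2).symm
  have := hco.dvd_of_dvd_mul_left h3
  exact_mod_cast this

lemma two_dvd_of (r b k : ℤ) (h : Int.gcd b r ∣ 2) (hk : r ∣ b * k) : r ∣ 2 * k := by
  obtain ⟨t, ht⟩ := h
  have e2 := Int.gcd_eq_gcd_ab b r
  have ht' : (2:ℤ) = (Int.gcd b r : ℤ) * t := by exact_mod_cast ht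
  rw [e2] at ht'
  have : 2 * k = (b * k) * (Int.gcdA b r * t) + r * (Int.gcdB b r * t * k) := by
    linear_combination k * ht'
  rw [this]
  exact dvd_add (hk.mul_right _) (dvd_mul_right _ _)

lemma mkData (r : ℤ) (δ : ℝ) (a b c d e : ℤ) (S : Set (Fin 4 → ℕ)) (B : Set (Fin 4 → ℚ))
    (hr : 13 < r) (hδ : δ ≤ 1/1000) (hW : WeightCond r a b c d e S) (hI : RuleI r a b c d δ S B)
    (hII : RuleII r a b c d e) (hS : FormSq S) :
    Data r a b c d (fun k => alphaK r a b c d k ∈ B) := by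
  have hr0 : 0 < r := by omega
  have hrR : (0:ℝ) < r := by exact_mod_cast hr0
  obtain ⟨i1, i2, i3, i4, c1, c2, c3, -, -, -, hsum⟩ := hII
  have he : r ∣ e - 2 * a := by
    have := (hW _ hS.1).dvd
    exact dvd_cg this (by simp)
  have gb := gdvd2 r a b e i2 c1 he
  have gc := gdvd2 r a c e i3 c2 he
  have gd := gdvd2 r a d e i4 c3 he
  obtain ⟨B1, B2, B3, B4⟩ := hI
  refine ⟨fun k => two_dvd_of r b k gb, fun k => two_dvd_of r c k gc,
    fun k => two_dvd_of r d k gd, ?_, ?_, ?_, ?_⟩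
  · have h1 := hsum.symm.dvd
    exact dvd_cg (dvd_add h1 he) (by ring)
  · intro k l hk hl
    exact alpha_inj r a b c d k l hr0 c1 (B1 hk hl)
  · intro k hk
    obtain ⟨-, h1, h2⟩ := B3 _ hk
    obtain ⟨m, hm, hv, -⟩ := vf_alpha r a b c d k hr0 S ⟨_, hS.1⟩
    rw [hv, w_alpha, ← sub_div] at h1 h2
    rw [div_lt_one hrR] at h2
    rw [lt_div_iff₀ hrR] at h1
    have h3 : (a*k)%r + (b*k)%r + (c*k)%r + (d*k)%r - val r a b c d k m < r := by exact_mod_cast h2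
    have h4 : (((a*k)%r + (b*k)%r + (c*k)%r + (d*k)%r - val r a b c d k m : ℤ) : ℝ) ≤ ((r - 1 : ℤ) : ℝ) := by
      exact_mod_cast (by omega)
    push_cast at h1 h4
    have h5 : (1000:ℝ) < r := by nlinarith
    exact_mod_cast h5
  · intro k hk
    obtain ⟨m, hm, hv, hmin⟩ := vf_alpha r a b c d k hr0 S ⟨_, hS.1⟩
    have nb := emod_neg_of r (b*k) hr0 (fun h => hk (two_dvd_of r b k gb h))
    have nc := emod_neg_of r (c*k) hr0 (fun h => hk (two_dvd_of r c k gc h))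
    have nd := emod_neg_of r (d*k) hr0 (fun h => hk (two_dvd_of r d k gd h))
    have na := Int.emod_nonneg (a*k) hr0.ne'
    refine ⟨val r a b c d k m, ?_, ?_, ?_, ?_, ?_⟩
    · have := nb.1
      have := nc.1
      have := nd.1
      unfold val; positivity
    · have := hmin _ hS.1
      simpa [val] using this
    · have h1 := (hW m hm).dvd
      have e1 := Int.mul_ediv_add_emod (b*k) r
      have e2 := Int.mul_ediv_add_emod (c*k) r
      have e3 := Int.mul_ediv_add_emod (d*k) r
      have e4 := Int.mul_ediv_add_emod (a*k) r
      obtain ⟨t, ht⟩ := h1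
      obtain ⟨t', ht'⟩ := he
      refine ⟨-(m 0 : ℤ) * (a*k/r) - (m 1 : ℤ) * (b*k/r) - (m 2 : ℤ) * (c*k/r)
        - (m 3 : ℤ) * (d*k/r) + 2 * (a*k/r) - t * k + t' * k, ?_⟩
      unfold val
      linear_combination (m 0 : ℤ) * e4 + (m 1 : ℤ) * e1 + (m 2 : ℤ) * e2 + (m 3 : ℤ) * e3
        - 2 * e4 - k * ht + k * ht'
    · intro hA
      have h2 := hS.2 m hm
      have h3 : (2:ℤ) ≤ m 0 + m 1 + m 2 + m 3 := by exact_mod_cast h2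
      have p0 : (m 0 : ℤ) * 1 ≤ (m 0 : ℤ) * ((a*k)%r) := by gcongr; omega
      have p1 : (m 1 : ℤ) * 1 ≤ (m 1 : ℤ) * ((b*k)%r) := by gcongr; have := nb.1; omega
      have p2 : (m 2 : ℤ) * 1 ≤ (m 2 : ℤ) * ((c*k)%r) := by gcongr; have := nc.1; omega
      have p3 : (m 3 : ℤ) * 1 ≤ (m 3 : ℤ) * ((d*k)%r) := by gcongr; have := nd.1; omega
      unfold val; linarith
    · intro hB
      have h1 := B4 _ (alpha_mem r a b c d k hr0) hB
        (alpha_not_corner r a b c d k hr0 (fun h => hk (two_dvd_of r b k gb h)))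
      rw [hv, w_alpha, ← sub_div, one_lt_div hrR] at h1
      exact_mod_cast h1

lemma gcd_trichotomy (r : ℤ) (δ : ℝ) (a b c d e : ℤ) (S : Set (Fin 4 → ℕ)) (B : Set (Fin 4 → ℚ))
    (hr : 13 < r) (hδ : δ ≤ 1/1000) (hW : WeightCond r a b c d e S) (hI : RuleI r a b c d δ S B)
    (hII : RuleII r a b c d e) (hS : FormSq S) : Int.gcd a r = 1 ∨ r ∣ a := by
  have H := mkData r δ a b c d e S B hr hδ hW hI hII hS
  obtain ⟨-, -, -, -, c1, c2, c3, -, -, -, -⟩ := hII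
  by_contra hcon
  push Not at hcon
  obtain ⟨h1, h2⟩ := hcon
  have hgpos : 0 < Int.gcd a r := Int.gcd_pos_of_ne_zero_right _ (by omega)
  have hco : ∀ x, Int.gcd a (Int.gcd x r) = 1 → IsCoprime x ((Int.gcd a r : ℕ) : ℤ) := by
    intro x hx
    rw [Int.isCoprime_iff_gcd_eq_one, ← hx, ← Int.gcd_assoc, ← Int.gcd_assoc, Int.gcd_comm x a]
  have k1 := hco b c1
  have k2 := hco c c2
  have k3 := hco d c3
  obtain ⟨a', ha'⟩ : ((Int.gcd a r : ℕ) : ℤ) ∣ a := Int.gcd_dvd_left ..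
  obtain ⟨s, hs⟩ : ((Int.gcd a r : ℕ) : ℤ) ∣ r := Int.gcd_dvd_right ..
  have hgZ : (2:ℤ) ≤ ((Int.gcd a r : ℕ) : ℤ) := by omega
  have hcp : IsCoprime a' s := by
    have e := Int.gcd_eq_gcd_ab a r
    refine ⟨Int.gcdA a r, Int.gcdB a r, ?_⟩
    have : ((Int.gcd a r : ℕ) : ℤ) * (Int.gcdA a r * a' + Int.gcdB a r * s)
        = ((Int.gcd a r : ℕ) : ℤ) * 1 := by
      linear_combination -e - Int.gcdA a r * ha' - Int.gcdB a r * hs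
    exact mul_left_cancel₀ (by omega) this
  generalize ((Int.gcd a r : ℕ) : ℤ) = g at *
  subst hs ha'
  have hs2 : 2 ≤ s := by
    by_contra hlt
    have hs0 : 0 < s := by
      by_contra h0
      nlinarith
    have : s = 1 := by omega
    subst this
    exact h2 ⟨a', by ring⟩
  exact core_false hgZ hs2 hr hcp k1 k2 k3 H

lemma nat_dvd_two {n : ℕ} (h : n ∣ 2) : n = 1 ∨ n = 2 := (Nat.dvd_prime Nat.prime_two).1 h

lemma gcd_two_iff (x r : ℤ) (h : Int.gcd x r ∣ 2) (hr : r % 2 = 0) :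
    (Int.gcd x r = 1 ∧ x % 2 = 1) ∨ (Int.gcd x r = 2 ∧ x % 2 = 0) := by
  rcases nat_dvd_two h with h1 | h1
  · left
    refine ⟨h1, ?_⟩
    by_contra h2
    have h3 : (2:ℤ) ∣ x := by omega
    have h4 : (2:ℤ) ∣ Int.gcd x r := Int.dvd_coe_gcd h3 (by omega)
    rw [h1] at h4
    omega
  · right
    refine ⟨h1, ?_⟩
    have : ((Int.gcd x r : ℕ) : ℤ) ∣ x := Int.gcd_dvd_left ..
    rw [h1] at this
    omega

lemma gcd_odd (x r : ℤ) (h : Int.gcd x r ∣ 2) (hr : r % 2 = 1) : Int.gcd x r = 1 := by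
  rcases nat_dvd_two h with h1 | h1
  · exact h1
  · have : ((Int.gcd x r : ℕ) : ℤ) ∣ r := Int.gcd_dvd_right ..
    rw [h1] at this
    omega

/-- Proposition (x²), part (2), in the square case. -/
theorem statement12 :
    ∃ δstar : ℝ, 0 < δstar ∧ δstar ≤ 1 / 13 ∧
      ∀ (r : ℤ) (δ : ℝ) (a b c d e : ℤ) (S : Set (Fin 4 → ℕ)) (B : Set (Fin 4 → ℚ)),
        13 < r → 0 < δ → δ ≤ δstar →
        WeightCond r a b c d e S → RuleI r a b c d δ S B → RuleII r a b c d e →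
        FormSq S →
        (Int.ModEq r a 0 ∧ Int.ModEq r e 0 ∧
          Int.gcd b r = 1 ∧ Int.gcd c r = 1 ∧ Int.gcd d r = 1) ∨
        (Odd r ∧ Int.gcd a r = 1 ∧ Int.gcd b r = 1 ∧ Int.gcd c r = 1 ∧
          Int.gcd d r = 1 ∧ Int.gcd e r = 1) ∨
        (Int.gcd d r = 2 ∧ Int.gcd e r = 2 ∧
          Int.gcd a r = 1 ∧ Int.gcd b r = 1 ∧ Int.gcd c r = 1) ∨
        (Int.gcd c r = 2 ∧ Int.gcd e r = 2 ∧
          Int.gcd a r = 1 ∧ Int.gcd b r = 1 ∧ Int.gcd d r = 1) ∨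
        (Int.gcd b r = 2 ∧ Int.gcd e r = 2 ∧
          Int.gcd a r = 1 ∧ Int.gcd c r = 1 ∧ Int.gcd d r = 1) := by
  refine ⟨1/1000, by norm_num, by norm_num, ?_⟩
  intro r δ a b c d e S B hr _ hδ hW hI hII hS
  have tri := gcd_trichotomy r δ a b c d e S B hr hδ hW hI hII hS
  obtain ⟨i1, i2, i3, i4, c1, c2, c3, c4, c5, c6, hsum⟩ := hII
  have he : r ∣ e - 2 * a := by
    have := (hW _ hS.1).dvd
    exact dvd_cg this (by simp)
  have gb := gdvd2 r a b e i2 c1 he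
  have gc := gdvd2 r a c e i3 c2 he
  have gd := gdvd2 r a d e i4 c3 he
  rcases tri with ha | ha
  · right
    have ge : Int.gcd e r ∣ 2 := by
      apply gdvd2 r a e e dvd_rfl _ he
      have h1 : Int.gcd a (Int.gcd e r) ∣ Int.gcd a r := by
        rw [Int.gcd_comm e r, ← Int.gcd_assoc]
        have := Int.gcd_dvd_left (a := ((Int.gcd a r : ℕ) : ℤ)) (b := e)
        exact_mod_cast this
      rw [ha] at h1
      exact Nat.dvd_one.1 h1
    rcases Int.emod_two_eq_zero_or_one r with h2 | h2
    · right
      have h1 := hsum.symm.dvd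
      obtain ⟨t, ht⟩ := h1
      obtain ⟨t', ht'⟩ := he
      have p1 : (r * t) % 2 = 0 := by rw [Int.mul_emod, h2]; simp
      have p2 : (r * t') % 2 = 0 := by rw [Int.mul_emod, h2]; simp
      have qa := gcd_two_iff a r (by rw [ha]; exact one_dvd 2) h2
      have qb := gcd_two_iff b r gb h2
      have qc := gcd_two_iff c r gc h2
      have qd := gcd_two_iff d r gd h2
      have qe := gcd_two_iff e r ge h2
      have x1 : ∀ x y : ℤ, Int.gcd x (Int.gcd y r) = 1 → Int.gcd y r = 2 → x % 2 = 1 := by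
        intro x y h h'
        rw [h'] at h
        by_contra h3
        have h4 : (2:ℤ) ∣ Int.gcd x ((2:ℕ):ℤ) := Int.dvd_coe_gcd (by omega) (by simp)
        rw [h] at h4
        omega
      have y1 := x1 b c c4
      have y2 := x1 b d c5
      have y3 := x1 c d c6
      have a1 : a % 2 = 1 := by
        rcases qa with ⟨_, q⟩ | ⟨q, _⟩
        · exact q
        · rw [ha] at q; omega
      have e0 : e % 2 = 0 := by omega
      have e1 : Int.gcd e r = 2 := by
        rcases qe with ⟨_, q⟩ | ⟨q, _⟩
        · omega
        · exact q
      have par : (b + c + d) % 2 = 0 := by omega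
      clear ht ht' p1 p2 qe x1 qa
      rcases qb with ⟨b1, b2⟩ | ⟨b1, b2⟩ <;> rcases qc with ⟨c1, c2⟩ | ⟨c1, c2⟩ <;>
        rcases qd with ⟨d1, d2⟩ | ⟨d1, d2⟩
      · omega
      · exact Or.inl ⟨d1, e1, ha, b1, c1⟩
      · exact Or.inr (Or.inl ⟨c1, e1, ha, b1, d1⟩)
      · omega
      · exact Or.inr (Or.inr ⟨b1, e1, ha, c1, d1⟩)
      · have := y2 d1; omega
      · have := y1 c1; omega
      · omega
    · left
      exact ⟨Int.odd_iff.2 h2, ha, gcd_odd b r gb h2, gcd_odd c r gc h2, gcd_odd d r gd h2,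
        gcd_odd e r ge h2⟩
  · left
    have z : ∀ x, Int.gcd a (Int.gcd x r) = 1 → Int.gcd x r = 1 := by
      intro x hx
      have h1 : ((Int.gcd x r : ℕ) : ℤ) ∣ a := (Int.gcd_dvd_right ..).trans ha
      have h2 : ((Int.gcd x r : ℕ) : ℤ) ∣ Int.gcd a (Int.gcd x r) := Int.dvd_coe_gcd h1 dvd_rfl
      rw [hx] at h2
      have h3 : Int.gcd x r ∣ 1 := by exact_mod_cast h2
      exact Nat.dvd_one.1 h3
    refine ⟨(Int.modEq_zero_iff_dvd).2 ha, (Int.modEq_zero_iff_dvd).2 ?_, z b c1, z c c2, z d c3⟩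
    exact dvd_cg (dvd_add he (ha.mul_left 2)) (by ring)

end GapPaper
end
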